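/- arXiv:2501.02695 — 3 statements merged into one kernel-verified Lean document; each statement's English description precedes it below -/
import Mathlib

section
/- h(N) ≥ π(N) + (1/2)·π(N^{1/2}) − o(π(N^{1/2})); that is, for every ε > 0 there exists N₀ ∈ ℕ such that for all N ≥ N₀, h(N) ≥ π(N) + (1/2)·π(N^{1/2}) − ε·π(N^{1/2}). -/
/-- A set of positive integers has *distinct subset products* if any two distinct
finite subsets have distinct products (the empty product is `1`). -/
def DistinctSubsetProds (A : Set ℕ) : Prop :=
  ∀ B C : Finset ℕ, ↑B ⊆ A → ↑C ⊆ A → ∏ b ∈ B, b = ∏ c ∈ C, c → B = C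

/-- `primePi x` is the number of primes `p` with `(p : ℝ) ≤ x`. -/
noncomputable def primePi (x : ℝ) : ℕ := {p : ℕ | p.Prime ∧ (p : ℝ) ≤ x}.ncard

/-- `maxSqfreeDSP N` is the maximal size of a subset of `{1, …, N}` consisting of
squarefree integers and having distinct subset products. -/
noncomputable def maxSqfreeDSP (N : ℕ) : ℕ :=
  sSup {k | ∃ A : Finset ℕ, ↑A ⊆ Set.Icc 1 N ∧ (∀ a ∈ A, Squarefree a) ∧
    DistinctSubsetProds ↑A ∧ A.card = k}

open Finset in
theorem card_le_maxSqfreeDSP {ι : Type*} {N : ℕ} (I : Finset ι) (f : ι → ℕ)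
    (hN : ∀ i ∈ I, f i ≤ N) (hs : ∀ i ∈ I, Squarefree (f i))
    (h : ∀ S T : Finset ι, S ⊆ I → T ⊆ I → ∏ i ∈ S, f i = ∏ i ∈ T, f i → S = T) :
    #I ≤ maxSqfreeDSP N := by
  classical
  have hinj : Set.InjOn f I := by
    intro i hi j hj hij
    have := h {i} {j} (by simpa using hi) (by simpa using hj) (by simpa using hij)
    simpa using this
  apply le_csSup
  · refine ⟨N, ?_⟩
    rintro k ⟨A, hA, -, -, rfl⟩
    have : A ⊆ Icc 1 N := by
      intro a ha
      simpa using hA ha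
    simpa using card_le_card this
  · refine ⟨I.image f, ?_, ?_, ?_, card_image_of_injOn hinj⟩
    · intro x hx
      obtain ⟨i, hi, rfl⟩ := mem_image.1 (mem_coe.1 hx)
      exact ⟨(hs i hi).ne_zero.bot_lt, hN i hi⟩
    · intro x hx
      obtain ⟨i, hi, rfl⟩ := mem_image.1 hx
      exact hs i hi
    · intro B C hB hC hBC
      obtain ⟨S, hS, rfl⟩ := subset_image_iff.1 (coe_subset.1 hB)
      obtain ⟨T, hT, rfl⟩ := subset_image_iff.1 (coe_subset.1 hC)
      rw [prod_image (hinj.mono hS), prod_image (hinj.mono hT)] at hBC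
      rw [h S T hS hT hBC]

open Finset in
/-- Replacing the primes `b i`, `q i` of pairwise disjoint prime triples by the three pairwise
products gains one element per triple. -/
theorem primeCounting_add_le_maxSqfreeDSP {N M : ℕ} (a b q : ℕ → ℕ)
    (ha : ∀ i < M, (a i).Prime) (hb : ∀ i < M, (b i).Prime) (hq : ∀ i < M, (q i).Prime)
    (ia : ∀ i < M, ∀ j < M, a i = a j → i = j) (ib : ∀ i < M, ∀ j < M, b i = b j → i = j)
    (iq : ∀ i < M, ∀ j < M, q i = q j → i = j)
    (hab : ∀ i < M, ∀ j < M, a i ≠ b j) (haq : ∀ i < M, ∀ j < M, a i ≠ q j)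
    (hbq : ∀ i < M, ∀ j < M, b i ≠ q j)
    (lab : ∀ i < M, a i * b i ≤ N) (laq : ∀ i < M, a i * q i ≤ N) (lbq : ∀ i < M, b i * q i ≤ N) :
    Nat.primeCounting N + M ≤ maxSqfreeDSP N := by
  classical
  obtain ⟨c, hcb, hcq, hc1⟩ : ∃ c : ℕ → ℕ, (∀ i < M, c (b i) = a i) ∧ (∀ i < M, c (q i) = a i) ∧
      ∀ p, (∀ i < M, p ≠ b i ∧ p ≠ q i) → c p = 1 := by
    refine ⟨fun p ↦ if h : ∃ i < M, p = b i ∨ p = q i then a h.choose else 1, ?_, ?_, ?_⟩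
    · intro i hi
      have h : ∃ j < M, b i = b j ∨ b i = q j := ⟨i, hi, .inl rfl⟩
      beta_reduce
      rw [dif_pos h]
      rcases h.choose_spec with ⟨h1, h2 | h2⟩
      · rw [← ib _ hi _ h1 h2]
      · exact absurd h2 (hbq _ hi _ h1)
    · intro i hi
      have h : ∃ j < M, q i = b j ∨ q i = q j := ⟨i, hi, .inr rfl⟩
      beta_reduce
      rw [dif_pos h]
      rcases h.choose_spec with ⟨h1, h2 | h2⟩
      · exact absurd h2.symm (hbq _ h1 _ hi)
      · rw [← iq _ hi _ h1 h2]
    · intro p hp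
      beta_reduce
      rw [dif_neg]
      rintro ⟨i, hi, h | h⟩
      · exact (hp i hi).1 h
      · exact (hp i hi).2 h
  set P : Finset ℕ := (range (N + 1)).filter Nat.Prime with hP
  have hPcard : #P = Nat.primeCounting N := by
    rw [Nat.primeCounting, Nat.primeCounting', Nat.count_eq_card_filter_range]
  have hcases : ∀ p, (∃ i < M, p = b i) ∨ (∃ i < M, p = q i) ∨ (∀ i < M, p ≠ b i ∧ p ≠ q i) := by
    intro p
    by_contra! h
    obtain ⟨h1, h2, i, hi, h3⟩ := h
    exact h2 i hi (h3 (h1 i hi))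
  have hcfact : ∀ p r, Nat.Prime p → r.Prime →
      (p * c p).factorization r = (if p = r then 1 else 0) + (if c p = r then 1 else 0) := by
    intro p r hp hr
    rcases hcases p with ⟨i, hi, rfl⟩ | ⟨i, hi, rfl⟩ | h
    · rw [hcb i hi, Nat.factorization_mul hp.ne_zero (ha i hi).ne_zero, hp.factorization,
        (ha i hi).factorization]
      simp [Finsupp.single_apply]
    · rw [hcq i hi, Nat.factorization_mul hp.ne_zero (ha i hi).ne_zero, hp.factorization,
        (ha i hi).factorization]
      simp [Finsupp.single_apply]
    · rw [hc1 p h, mul_one, hp.factorization]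
      simp [Finsupp.single_apply, hr.ne_one.symm]
  have hbqfact : ∀ i < M, ∀ r,
      (b i * q i).factorization r = (if b i = r then 1 else 0) + (if q i = r then 1 else 0) := by
    intro i hi r
    rw [Nat.factorization_mul (hb i hi).ne_zero (hq i hi).ne_zero, (hb i hi).factorization,
      (hq i hi).factorization]
    simp [Finsupp.single_apply]
  have hsq : ∀ {x y : ℕ}, x.Prime → y.Prime → x ≠ y → Squarefree (x * y) := by
    intro x y hx hy hxy
    exact (Nat.squarefree_mul ((Nat.coprime_primes hx hy).2 hxy)).2 ⟨hx.squarefree, hy.squarefree⟩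
  have hc0 : ∀ p, c p ≠ 0 := by
    intro p
    rcases hcases p with ⟨i, hi, rfl⟩ | ⟨i, hi, rfl⟩ | h
    · rw [hcb i hi]; exact (ha i hi).ne_zero
    · rw [hcq i hi]; exact (ha i hi).ne_zero
    · simp [hc1 p h]
  let f : ℕ ⊕ ℕ → ℕ := Sum.elim (fun p ↦ p * c p) (fun i ↦ b i * q i)
  have key := card_le_maxSqfreeDSP (N := N) (P.disjSum (range M)) f ?_ ?_ ?_
  · simpa [hPcard] using key
  · rintro (p | i) hx
    · obtain ⟨hpN, hp⟩ : p < N + 1 ∧ p.Prime := by simpa [hP] using hx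
      change p * c p ≤ N
      rcases hcases p with ⟨i, hi, rfl⟩ | ⟨i, hi, rfl⟩ | h
      · rw [hcb i hi, mul_comm]; exact lab i hi
      · rw [hcq i hi, mul_comm]; exact laq i hi
      · rw [hc1 p h]; omega
    · exact lbq i (by simpa using hx)
  · rintro (p | i) hx
    · obtain ⟨hpN, hp⟩ : p < N + 1 ∧ p.Prime := by simpa [hP] using hx
      change Squarefree (p * c p)
      rcases hcases p with ⟨i, hi, rfl⟩ | ⟨i, hi, rfl⟩ | h
      · rw [hcb i hi]; exact hsq hp (ha i hi) (hab i hi i hi).symm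
      · rw [hcq i hi]; exact hsq hp (ha i hi) (haq i hi i hi).symm
      · rw [hc1 p h, mul_one]; exact hp.squarefree
    · have hi : i < M := by simpa using hx
      exact hsq (hb i hi) (hq i hi) (hbq i hi i hi)
  · have hPr : ∀ {S : Finset (ℕ ⊕ ℕ)}, S ⊆ P.disjSum (range M) → ∀ p ∈ S.toLeft, p.Prime := by
      intro S hS p hp
      have := hS (mem_toLeft.1 hp)
      simp only [hP, inl_mem_disjSum, mem_filter] at this
      exact this.2
    have hRt : ∀ {S : Finset (ℕ ⊕ ℕ)}, S ⊆ P.disjSum (range M) → ∀ i ∈ S.toRight, i < M := by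
      intro S hS i hi
      have := hS (mem_toRight.1 hi)
      simpa using this
    have hval : ∀ S ⊆ P.disjSum (range M), ∀ r, r.Prime →
        (∏ x ∈ S, f x).factorization r = (if r ∈ S.toLeft then 1 else 0) +
          ∑ p ∈ S.toLeft, (if c p = r then 1 else 0) +
          ∑ i ∈ S.toRight, ((if b i = r then 1 else 0) + (if q i = r then 1 else 0)) := by
      intro S hS r hr
      have e1 : ∏ x ∈ S, f x =
          (∏ p ∈ S.toLeft, p * c p) * ∏ i ∈ S.toRight, b i * q i := by
        conv_lhs => rw [← toLeft_disjSum_toRight (u := S)]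
        rw [prod_disjSum]
        simp [f]
      have n1 : ∀ p ∈ S.toLeft, p * c p ≠ 0 := fun p hp ↦ mul_ne_zero (hPr hS p hp).ne_zero (hc0 p)
      have n2 : ∀ i ∈ S.toRight, b i * q i ≠ 0 := fun i hi ↦
        mul_ne_zero (hb i (hRt hS i hi)).ne_zero (hq i (hRt hS i hi)).ne_zero
      rw [e1, Nat.factorization_mul (prod_ne_zero_iff.2 n1) (prod_ne_zero_iff.2 n2),
        Nat.factorization_prod n1, Nat.factorization_prod n2, Finsupp.add_apply,
        Finsupp.finsetSum_apply, Finsupp.finsetSum_apply,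
        sum_congr rfl fun p hp ↦ hcfact p r (hPr hS p hp) hr,
        sum_congr rfl fun i hi ↦ hbqfact i (hRt hS i hi) r, sum_add_distrib]
      simp
    intro S T hS hT hST
    have vb : ∀ S ⊆ P.disjSum (range M), ∀ i < M, (∏ x ∈ S, f x).factorization (b i) =
        (if b i ∈ S.toLeft then 1 else 0) + (if i ∈ S.toRight then 1 else 0) := by
      intro S hS i hi
      rw [hval S hS _ (hb i hi), sum_eq_zero (s := S.toLeft), add_zero]
      · congr 1
        rw [← sum_ite_eq' S.toRight i (fun _ ↦ 1)]
        refine sum_congr rfl fun j hj ↦ ?_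
        rw [if_neg (hbq i hi j (hRt hS j hj)).symm, add_zero]
        refine if_congr ⟨fun h ↦ ib _ (hRt hS j hj) _ hi h, fun h ↦ by rw [h]⟩ rfl rfl
      · intro p hp
        rw [if_neg]
        rcases hcases p with ⟨j, hj, rfl⟩ | ⟨j, hj, rfl⟩ | h
        · rw [hcb j hj]; exact hab j hj i hi
        · rw [hcq j hj]; exact hab j hj i hi
        · rw [hc1 p h]; exact (hb i hi).ne_one.symm
    have vq : ∀ S ⊆ P.disjSum (range M), ∀ i < M, (∏ x ∈ S, f x).factorization (q i) =
        (if q i ∈ S.toLeft then 1 else 0) + (if i ∈ S.toRight then 1 else 0) := by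
      intro S hS i hi
      rw [hval S hS _ (hq i hi), sum_eq_zero (s := S.toLeft), add_zero]
      · congr 1
        rw [← sum_ite_eq' S.toRight i (fun _ ↦ 1)]
        refine sum_congr rfl fun j hj ↦ ?_
        rw [if_neg (hbq j (hRt hS j hj) i hi), zero_add]
        refine if_congr ⟨fun h ↦ iq _ (hRt hS j hj) _ hi h, fun h ↦ by rw [h]⟩ rfl rfl
      · intro p hp
        rw [if_neg]
        rcases hcases p with ⟨j, hj, rfl⟩ | ⟨j, hj, rfl⟩ | h
        · rw [hcb j hj]; exact haq j hj i hi
        · rw [hcq j hj]; exact haq j hj i hi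
        · rw [hc1 p h]; exact (hq i hi).ne_one.symm
    have va : ∀ S ⊆ P.disjSum (range M), ∀ i < M, (∏ x ∈ S, f x).factorization (a i) =
        (if a i ∈ S.toLeft then 1 else 0) +
          ((if b i ∈ S.toLeft then 1 else 0) + (if q i ∈ S.toLeft then 1 else 0)) := by
      intro S hS i hi
      rw [hval S hS _ (ha i hi), sum_eq_zero (s := S.toRight), add_zero]
      · congr 1
        rw [← sum_ite_eq' S.toLeft (b i) (fun _ ↦ 1), ← sum_ite_eq' S.toLeft (q i) (fun _ ↦ 1),
          ← sum_add_distrib]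
        refine sum_congr rfl fun p hp ↦ ?_
        rcases hcases p with ⟨j, hj, rfl⟩ | ⟨j, hj, rfl⟩ | h
        · rw [hcb j hj, if_neg (hbq j hj i hi), add_zero]
          exact if_congr ⟨fun h ↦ by rw [ia _ hj _ hi h], fun h ↦ by rw [ib _ hj _ hi h]⟩ rfl rfl
        · rw [hcq j hj, if_neg (hbq i hi j hj).symm, zero_add]
          exact if_congr ⟨fun h ↦ by rw [ia _ hj _ hi h], fun h ↦ by rw [iq _ hj _ hi h]⟩ rfl rfl
        · rw [hc1 p h, if_neg (ha i hi).ne_one.symm, if_neg (h i hi).1, if_neg (h i hi).2,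
            add_zero]
      · intro j hj
        rw [if_neg (hab i hi j (hRt hS j hj)).symm, if_neg (haq i hi j (hRt hS j hj)).symm,
          add_zero]
    have hsolve : ∀ i < M, (i ∈ S.toRight ↔ i ∈ T.toRight) ∧ (a i ∈ S.toLeft ↔ a i ∈ T.toLeft) ∧
        (b i ∈ S.toLeft ↔ b i ∈ T.toLeft) ∧ (q i ∈ S.toLeft ↔ q i ∈ T.toLeft) := by
      intro i hi
      have h1 := va S hS i hi
      have h2 := vb S hS i hi
      have h3 := vq S hS i hi
      rw [hST, va T hT i hi] at h1
      rw [hST, vb T hT i hi] at h2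
      rw [hST, vq T hT i hi] at h3
      have hle : ∀ (p : Prop) [Decidable p], (if p then 1 else 0) ≤ 1 := fun p _ ↦ by
        split_ifs <;> simp
      have hiff : ∀ (p q : Prop) [Decidable p] [Decidable q],
          (if p then 1 else 0) = (if q then 1 else 0) → (p ↔ q) := fun p q _ _ h ↦ by
        split_ifs at h <;> tauto
      have := hle (a i ∈ S.toLeft)
      have := hle (a i ∈ T.toLeft)
      refine ⟨hiff _ _ ?_, hiff _ _ ?_, hiff _ _ ?_, hiff _ _ ?_⟩ <;> omega
    have hright : S.toRight = T.toRight := by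
      ext i
      exact ⟨fun h ↦ (hsolve i (hRt hS i h)).1.1 h, fun h ↦ (hsolve i (hRt hT i h)).1.2 h⟩
    have hleft : S.toLeft = T.toLeft := by
      ext p
      rcases hcases p with ⟨j, hj, rfl⟩ | ⟨j, hj, rfl⟩ | h
      · exact (hsolve j hj).2.2.1
      · exact (hsolve j hj).2.2.2
      by_cases hpa : ∃ i < M, p = a i
      · obtain ⟨i, hi, rfl⟩ := hpa
        exact (hsolve i hi).2.1
      by_cases hp : p.Prime
      · have hv : ∀ S ⊆ P.disjSum (range M), (∏ x ∈ S, f x).factorization p =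
            (if p ∈ S.toLeft then 1 else 0) := by
          intro S hS
          rw [hval S hS p hp, sum_eq_zero, sum_eq_zero, add_zero, add_zero]
          · intro i hi
            rw [if_neg (h i (hRt hS i hi)).1.symm, if_neg (h i (hRt hS i hi)).2.symm,
              add_zero]
          · intro r hr
            push Not at hpa
            rw [if_neg]
            rcases hcases r with ⟨j, hj, rfl⟩ | ⟨j, hj, rfl⟩ | h
            · rw [hcb j hj]; exact (hpa j hj).symm
            · rw [hcq j hj]; exact (hpa j hj).symm
            · rw [hc1 r h]; exact hp.ne_one.symm
        have h1 := hv S hS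
        rw [hST, hv T hT] at h1
        split_ifs at h1 <;> tauto
      · exact ⟨fun h ↦ absurd (hPr hS p h) hp, fun h ↦ absurd (hPr hT p h) hp⟩
    rw [← toLeft_disjSum_toRight (u := S), ← toLeft_disjSum_toRight (u := T), hleft, hright]

namespace WienerIkehara

open MeasureTheory Filter Topology Set

/-- The triangle function `t ↦ max 0 (1 - |t|)`. -/
noncomputable def triangle (t : ℝ) : ℝ := max 0 (1 - |t|)

/-- The Fejér kernel, the Fourier transform of `triangle`. -/
noncomputable def fejer (v : ℝ) : ℝ := Real.sinc (v / 2) ^ 2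

theorem continuous_triangle : Continuous triangle := by
  unfold triangle; fun_prop

theorem continuous_fejer : Continuous fejer := by
  unfold fejer
  have := Real.continuous_sinc
  fun_prop

theorem triangle_nonneg (t : ℝ) : 0 ≤ triangle t := le_max_left _ _

theorem triangle_eq_zero {t : ℝ} (ht : 1 ≤ |t|) : triangle t = 0 := max_eq_left (by linarith)

theorem integrable_triangle : Integrable triangle := by
  refine continuous_triangle.integrable_of_hasCompactSupport ?_
  refine HasCompactSupport.intro (isCompact_Icc (a := (-1 : ℝ)) (b := 1)) fun t ht ↦
    triangle_eq_zero ?_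
  by_contra! h
  exact ht ⟨(abs_lt.1 h).1.le, (abs_lt.1 h).2.le⟩

theorem fejer_nonneg (v : ℝ) : 0 ≤ fejer v := sq_nonneg _

theorem fejer_le (v : ℝ) : fejer v ≤ 8 * (1 + v ^ 2)⁻¹ := by
  unfold fejer
  have h1 : Real.sinc (v / 2) ^ 2 ≤ 1 := by
    rw [sq_le_one_iff_abs_le_one]; exact Real.abs_sinc_le_one _
  rw [← div_eq_mul_inv, le_div_iff₀ (by positivity)]
  have h2 : Real.sinc (v / 2) ^ 2 * v ^ 2 ≤ 4 := by
    rcases eq_or_ne v 0 with rfl | hv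
    · simp
    · rw [Real.sinc_of_ne_zero (by simpa using hv)]
      have : (Real.sin (v / 2) / (v / 2)) ^ 2 * v ^ 2 = 4 * Real.sin (v / 2) ^ 2 := by
        field_simp; ring
      rw [this]
      nlinarith [Real.sin_sq_le_one (v / 2)]
  nlinarith

theorem integrable_fejer : Integrable fejer := by
  refine (integrable_inv_one_add_sq.const_mul 8).mono' continuous_fejer.aestronglyMeasurable ?_
  exact .of_forall fun v ↦ by
    rw [Real.norm_of_nonneg (fejer_nonneg v)]; exact fejer_le v

theorem integral_fejer_pos : 0 < ∫ v, fejer v := by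
  refine integral_pos_of_integrable_nonneg_nonzero (x := 0) continuous_fejer integrable_fejer
    fejer_nonneg ?_
  simp [fejer]

theorem integral_triangle_mul_cexp (v : ℝ) :
    ∫ t, (triangle t : ℂ) * Complex.exp (Complex.I * v * t) = fejer v := by
  have h0 : ∫ t, (triangle t : ℂ) * Complex.exp (Complex.I * v * t) =
      ∫ t in (-1 : ℝ)..1, (triangle t : ℂ) * Complex.exp (Complex.I * v * t) := by
    rw [intervalIntegral.integral_of_le (by norm_num),
      setIntegral_eq_integral_of_forall_compl_eq_zero]
    intro t ht
    rw [triangle_eq_zero, Complex.ofReal_zero, zero_mul]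
    by_contra! h
    exact ht ⟨(abs_lt.1 h).1, (abs_lt.1 h).2.le⟩
  have hcont : Continuous fun t : ℝ ↦ (triangle t : ℂ) * Complex.exp (Complex.I * v * t) := by
    have := continuous_triangle
    fun_prop
  rw [h0, ← intervalIntegral.integral_add_adjacent_intervals (b := 0)
    (hcont.intervalIntegrable _ _) (hcont.intervalIntegrable _ _)]
  set c : ℂ := Complex.I * v with hc
  have e1 : ∫ t in (-1 : ℝ)..0, (triangle t : ℂ) * Complex.exp (c * t) =
      ∫ t in (-1 : ℝ)..0, (1 + t : ℂ) * Complex.exp (c * t) := by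
    refine intervalIntegral.integral_congr fun t ht ↦ ?_
    rw [uIcc_of_le (by norm_num)] at ht
    simp only [triangle]
    rw [abs_of_nonpos ht.2, max_eq_right (by linarith [ht.1])]
    push_cast; ring_nf
  have e2 : ∫ t in (0 : ℝ)..1, (triangle t : ℂ) * Complex.exp (c * t) =
      ∫ t in (0 : ℝ)..1, (1 - t : ℂ) * Complex.exp (c * t) := by
    refine intervalIntegral.integral_congr fun t ht ↦ ?_
    rw [uIcc_of_le (by norm_num)] at ht
    simp only [triangle]
    rw [abs_of_nonneg ht.1, max_eq_right (by linarith [ht.2])]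
    push_cast; ring_nf
  rw [e1, e2]
  rcases eq_or_ne v 0 with rfl | hv
  · have h1 : ∫ t in (-1 : ℝ)..0, (1 + t : ℂ) = ((1 / 2 : ℝ) : ℂ) := by
      rw [← intervalIntegral.integral_congr (f := fun t : ℝ ↦ ((1 + t : ℝ) : ℂ))
        fun t _ ↦ by push_cast; rfl, intervalIntegral.integral_ofReal, intervalIntegral.integral_add
          (by simp) (by simp)]
      norm_num
    have h2 : ∫ t in (0 : ℝ)..1, (1 - t : ℂ) = ((1 / 2 : ℝ) : ℂ) := by
      rw [← intervalIntegral.integral_congr (f := fun t : ℝ ↦ ((1 - t : ℝ) : ℂ))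
        fun t _ ↦ by push_cast; rfl, intervalIntegral.integral_ofReal, intervalIntegral.integral_sub
          (by simp) (by simp)]
      norm_num
    simp only [hc, Complex.ofReal_zero, mul_zero, zero_mul, Complex.exp_zero, mul_one, h1, h2]
    norm_num [fejer]
  have hc0 : c ≠ 0 := by simp [hc, hv]
  have hexp (t : ℝ) : HasDerivAt (fun t : ℝ ↦ Complex.exp (c * t)) (Complex.exp (c * t) * c) t := by
    have h := (Complex.ofRealCLM.hasDerivAt (x := t)).const_mul c
    simpa using h.cexp
  have hid (t : ℝ) : HasDerivAt (fun t : ℝ ↦ (t : ℂ)) 1 t := Complex.ofRealCLM.hasDerivAt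
  rw [intervalIntegral.integral_eq_sub_of_hasDerivAt
      (f := fun t : ℝ ↦ (1 + t : ℂ) * Complex.exp (c * t) / c - Complex.exp (c * t) / c ^ 2)
      ?_ (Continuous.intervalIntegrable (by fun_prop) _ _),
    intervalIntegral.integral_eq_sub_of_hasDerivAt
      (f := fun t : ℝ ↦ (1 - t : ℂ) * Complex.exp (c * t) / c + Complex.exp (c * t) / c ^ 2)
      ?_ (Continuous.intervalIntegrable (by fun_prop) _ _)]
  · have hcos : Complex.exp c + Complex.exp (-c) = 2 * Real.cos v := by
      rw [Complex.ofReal_cos, Complex.cos, hc]; ring_nf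
    have hf : (fejer v : ℂ) = 2 * (1 - Real.cos v) / v ^ 2 := by
      have : fejer v = 2 * (1 - Real.cos v) / v ^ 2 := by
        rw [fejer, Real.sinc_of_ne_zero (by simpa using hv), div_pow, Real.sin_sq_eq_half_sub]
        rw [show 2 * (v / 2) = v by ring]
        field_simp
      rw [this]; push_cast; rfl
    have hv' : (v : ℂ) ≠ 0 := by exact_mod_cast hv
    have hc2 : c ^ 2 = - (v : ℂ) ^ 2 := by rw [hc, mul_pow, Complex.I_sq]; ring
    rw [hf]
    have : Complex.exp (-c) = 2 * Real.cos v - Complex.exp c := by rw [← hcos]; ring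
    simp only [Complex.ofReal_zero, mul_zero, Complex.exp_zero, Complex.ofReal_neg,
      Complex.ofReal_one, mul_neg, mul_one, this, hc2]
    field_simp
    ring
  · intro t _
    refine (((((hid t).const_sub 1).mul (hexp t)).div_const c).add
      ((hexp t).div_const (c ^ 2))).congr_deriv ?_
    field_simp
    ring
  · intro t _
    refine (((((hid t).const_add 1).mul (hexp t)).div_const c).sub
      ((hexp t).div_const (c ^ 2))).congr_deriv ?_
    field_simp
    ring

/-- Averages of `b` against Fejér kernels tend to zero when the Laplace transform of the bounded
function `b` extends continuously to the closed right half-plane. -/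
theorem tendsto_integral_mul_fejer {b : ℝ → ℝ} {C : ℝ} {G : ℂ → ℂ} (hb : Measurable b)
    (hC : ∀ u, |b u| ≤ C) (hG : ContinuousOn G {s | 0 ≤ s.re})
    (hGb : ∀ s : ℂ, 0 < s.re → G s = ∫ u in Ioi (0 : ℝ), (b u : ℂ) * Complex.exp (-s * u))
    {l : ℝ} (hl : 0 < l) :
    Tendsto (fun x ↦ ∫ u in Ioi (0 : ℝ), b u * fejer (l * (x - u))) atTop (𝓝 0) := by
  have hbC : Measurable fun u ↦ (b u : ℂ) := Complex.measurable_ofReal.comp hb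
  have hC0 : 0 ≤ C := (abs_nonneg _).trans (hC 0)
  have hline (σ : ℝ) (hσ : 0 ≤ σ) : Continuous fun t : ℝ ↦ G (σ + Complex.I * (l * t)) := by
    refine hG.comp_continuous (by fun_prop) fun t ↦ ?_
    simpa using hσ
  have hfub (σ : ℝ) (hσ : 0 < σ) (x : ℝ) :
      ∫ u in Ioi (0 : ℝ), (b u : ℂ) * Complex.exp (-σ * u) * fejer (l * (x - u)) =
        ∫ t, triangle t * (Complex.exp (Complex.I * (l * x) * t) *
          G (σ + Complex.I * (l * t))) := by
    have hinteg : Integrable (fun u : ℝ ↦ (b u : ℂ) * Complex.exp (-σ * u))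
        (volume.restrict (Ioi 0)) := by
      have h1 : Integrable (fun u : ℝ ↦ Real.exp (-σ * u)) (volume.restrict (Ioi 0)) :=
        exp_neg_integrableOn_Ioi 0 hσ
      have h2 : Integrable (fun u : ℝ ↦ Complex.exp (-σ * u)) (volume.restrict (Ioi 0)) := by
        simpa using h1.ofReal (𝕜 := ℂ)
      exact h2.bdd_mul (c := C) hbC.aestronglyMeasurable
        (.of_forall fun u ↦ by simpa using hC u)
    have hprod := (hinteg.mul_prod (integrable_triangle.ofReal (𝕜 := ℂ))).mul_bdd (c := 1)
      (g := fun p : ℝ × ℝ ↦ Complex.exp (Complex.I * (l * (x - p.1) : ℝ) * p.2))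
      (Continuous.aestronglyMeasurable (by fun_prop)) (.of_forall fun p ↦ by
        rw [Complex.norm_exp]; simp)
    calc _ = ∫ u in Ioi (0 : ℝ), ∫ t, (b u : ℂ) * Complex.exp (-σ * u) * triangle t *
            Complex.exp (Complex.I * (l * (x - u) : ℝ) * t) := by
          refine integral_congr_ae (.of_forall fun u ↦ ?_)
          simp only [mul_assoc]
          rw [integral_const_mul, integral_const_mul, ← integral_triangle_mul_cexp]
          simp only [mul_assoc]
      _ = ∫ t, ∫ u in Ioi (0 : ℝ), (b u : ℂ) * Complex.exp (-σ * u) * triangle t *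
            Complex.exp (Complex.I * (l * (x - u) : ℝ) * t) := integral_integral_swap hprod
      _ = _ := by
          refine integral_congr_ae (.of_forall fun t ↦ ?_)
          beta_reduce
          rw [hGb _ (by simpa using hσ), ← integral_const_mul, ← integral_const_mul]
          refine integral_congr_ae (.of_forall fun u ↦ ?_)
          beta_reduce
          have : Complex.exp (-(σ + Complex.I * (l * t)) * u) *
              Complex.exp (Complex.I * (l * x) * t) = Complex.exp (-σ * u) *
              Complex.exp (Complex.I * (l * (x - u) : ℝ) * t) := by
            rw [← Complex.exp_add, ← Complex.exp_add]
            push_cast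
            ring_nf
          linear_combination (-(triangle t : ℂ) * b u) * this
  obtain ⟨M, hM⟩ : ∃ M, ∀ σ ∈ Icc (0 : ℝ) 1, ∀ t : ℝ, |t| ≤ 1 →
      ‖G (σ + Complex.I * (l * t))‖ ≤ M := by
    have hK : IsCompact (Icc (0 : ℝ) 1 ×ℂ Icc (-l) l) := isCompact_Icc.reProdIm isCompact_Icc
    obtain ⟨M, hM⟩ := hK.exists_bound_of_continuousOn (hG.mono fun s hs ↦ hs.1.1)
    refine ⟨M, fun σ hσ t ht ↦ hM _ ?_⟩
    rw [abs_le] at ht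
    refine ⟨by simpa using hσ, ?_⟩
    simp only [mem_preimage, Complex.add_im, Complex.ofReal_im, Complex.mul_im, Complex.I_re,
      Complex.I_im, Complex.ofReal_re, Complex.mul_re, mem_Icc]
    constructor <;> nlinarith [ht.1, ht.2]
  have hlim (x : ℝ) : ∫ u in Ioi (0 : ℝ), (b u : ℂ) * fejer (l * (x - u)) =
      ∫ t, triangle t * (Complex.exp (Complex.I * (l * x) * t) * G (Complex.I * (l * t))) := by
    have hL : Tendsto (fun σ : ℝ ↦
        ∫ u in Ioi (0 : ℝ), (b u : ℂ) * Complex.exp (-σ * u) * fejer (l * (x - u))) (𝓝[>] 0)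
        (𝓝 (∫ u in Ioi (0 : ℝ), (b u : ℂ) * fejer (l * (x - u)))) := by
      have hfc := continuous_fejer
      refine tendsto_integral_filter_of_dominated_convergence
        (fun u ↦ C * fejer (l * (x - u))) (.of_forall fun σ ↦ ?_) ?_ ?_ ?_
      · exact ((hbC.mul (Continuous.measurable (by fun_prop))).mul
          (Continuous.measurable (by fun_prop))).aestronglyMeasurable
      · filter_upwards [self_mem_nhdsWithin] with σ hσ
        filter_upwards [ae_restrict_mem measurableSet_Ioi] with u hu
        rw [norm_mul, norm_mul, Complex.norm_exp, Complex.norm_real, Complex.norm_real,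
          Real.norm_of_nonneg (fejer_nonneg _), Real.norm_eq_abs]
        refine mul_le_mul_of_nonneg_right ?_ (fejer_nonneg _)
        have h1 : Real.exp (-(σ : ℂ) * u).re ≤ 1 := by
          rw [Real.exp_le_one_iff]
          simp only [Complex.mul_re, Complex.neg_re, Complex.ofReal_re, Complex.neg_im,
            Complex.ofReal_im]
          nlinarith [mul_pos (mem_Ioi.1 hσ) (mem_Ioi.1 hu)]
        calc |b u| * _ ≤ C * 1 := mul_le_mul (hC u) h1 (Real.exp_nonneg _) hC0
          _ = C := mul_one C
      · have := ((integrable_fejer.comp_mul_left' hl.ne').comp_sub_left x).const_mul C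
        exact this.integrableOn
      · refine .of_forall fun u ↦ ?_
        have : Continuous fun σ : ℝ ↦
            (b u : ℂ) * Complex.exp (-σ * u) * fejer (l * (x - u)) := by fun_prop
        have h := (this.tendsto 0).mono_left (nhdsWithin_le_nhds (s := Ioi 0))
        simpa using h
    have hR : Tendsto (fun σ : ℝ ↦ ∫ t, triangle t * (Complex.exp (Complex.I * (l * x) * t) *
          G (σ + Complex.I * (l * t)))) (𝓝[>] 0)
        (𝓝 (∫ t, triangle t * (Complex.exp (Complex.I * (l * x) * t) *
          G (Complex.I * (l * t))))) := by
      have htc := continuous_triangle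
      refine tendsto_integral_filter_of_dominated_convergence
        (fun t ↦ triangle t * M) ?_ ?_ (integrable_triangle.mul_const M) ?_
      · filter_upwards [self_mem_nhdsWithin] with σ hσ
        have := hline σ (le_of_lt hσ)
        have he : Continuous fun t : ℝ ↦ Complex.exp (Complex.I * (l * x) * t) := by fun_prop
        exact ((Complex.continuous_ofReal.comp htc).mul (he.mul this)).aestronglyMeasurable
      · filter_upwards [Ioo_mem_nhdsGT (zero_lt_one' ℝ)] with σ hσ
        refine .of_forall fun t ↦ ?_
        rw [norm_mul, norm_mul, Complex.norm_exp, Complex.norm_real,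
          Real.norm_of_nonneg (triangle_nonneg _)]
        rcases le_or_gt 1 |t| with ht | ht
        · simp [triangle_eq_zero ht]
        · refine mul_le_mul_of_nonneg_left ?_ (triangle_nonneg _)
          simpa using hM σ ⟨hσ.1.le, hσ.2.le⟩ t ht.le
      · refine .of_forall fun t ↦ ?_
        have hc : Tendsto (fun σ : ℝ ↦ (σ + Complex.I * (l * t) : ℂ)) (𝓝[>] 0)
            (𝓝[{s : ℂ | 0 ≤ s.re}] (Complex.I * (l * t))) := by
          refine tendsto_nhdsWithin_iff.2 ⟨?_, ?_⟩
          · have : Continuous fun σ : ℝ ↦ (σ + Complex.I * (l * t) : ℂ) := by fun_prop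
            have h := (this.tendsto 0).mono_left (nhdsWithin_le_nhds (s := Ioi 0))
            simpa using h
          · filter_upwards [self_mem_nhdsWithin] with σ hσ
            simpa using le_of_lt hσ
        exact (((hG _ (by simp)).tendsto.comp hc).const_mul _).const_mul _
    refine tendsto_nhds_unique (hL.congr' ?_) hR
    filter_upwards [self_mem_nhdsWithin] with σ hσ using hfub σ hσ x
  have hRL := (Real.tendsto_integral_exp_smul_cocompact
    fun t : ℝ ↦ (triangle t : ℂ) * G (Complex.I * (l * t))).comp
    (tendsto_id.const_mul_atTop_of_neg
      (show -(l / (2 * Real.pi)) < 0 by have := Real.pi_pos; simp; positivity)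
      |>.mono_right atBot_le_cocompact)
  have hre := (Complex.continuous_re.tendsto 0).comp hRL
  rw [Complex.zero_re] at hre
  refine hre.congr fun x ↦ ?_
  have h1 : ((∫ u in Ioi (0 : ℝ), b u * fejer (l * (x - u)) : ℝ) : ℂ) =
      ∫ u in Ioi (0 : ℝ), (b u : ℂ) * fejer (l * (x - u)) := by
    rw [← integral_complex_ofReal]
    push_cast
    rfl
  rw [← Complex.ofReal_re (∫ u in Ioi (0 : ℝ), b u * fejer (l * (x - u))), h1, hlim]
  simp only [Function.comp]
  congr 1
  refine integral_congr_ae (.of_forall fun t ↦ ?_)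
  simp only [Circle.smul_def, Real.fourierChar_apply, id, smul_eq_mul]
  have : Complex.exp (↑(2 * Real.pi * -(t * (-(l / (2 * Real.pi)) * x))) * Complex.I) =
      Complex.exp (Complex.I * (l * x) * t) := by
    congr 1
    have : (Real.pi : ℂ) ≠ 0 := by exact_mod_cast Real.pi_ne_zero
    push_cast
    field_simp
  rw [this]
  ring

/-- Rescaled Fejér averages over the positive half-line as averages over the real line. -/
theorem setIntegral_mul_fejer (f : ℝ → ℝ) {l : ℝ} (hl : 0 < l) (x : ℝ) :
    ∫ u in Ioi (0 : ℝ), f u * fejer (l * (x - u)) =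
      l⁻¹ * ∫ w, (Ioi 0).indicator f (x - l⁻¹ * w) * fejer w := by
  rw [← integral_indicator measurableSet_Ioi, ← integral_sub_left_eq_self _ volume x]
  have h := Measure.integral_comp_mul_left
    (fun w ↦ (Ioi 0).indicator f (x - l⁻¹ * w) * fejer w) l
  rw [abs_of_pos (inv_pos.2 hl), smul_eq_mul] at h
  rw [← h]
  refine integral_congr_ae (.of_forall fun v ↦ ?_)
  simp only [indicator, inv_mul_cancel_left₀ hl.ne', sub_sub_cancel]
  split_ifs <;> simp

/-- The shape of the Fejér averages of a bounded function close to `1` in the mean. -/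
theorem tendsto_integral_comp_mul_fejer {B : ℝ → ℝ} {C : ℝ} (hBm : Measurable B)
    (hB0 : ∀ u, 0 ≤ B u) (hBC : ∀ u, B u ≤ C) (hBz : ∀ u ≤ 0, B u = 0) {l : ℝ} (hl : 0 < l)
    (h : Tendsto (fun x ↦ ∫ u in Ioi (0 : ℝ), (B u - 1) * fejer (l * (x - u))) atTop (𝓝 0)) :
    Tendsto (fun x ↦ ∫ w, B (x - l⁻¹ * w) * fejer w) atTop (𝓝 (∫ w, fejer w)) := by
  have hind : Tendsto (fun x ↦ ∫ w, (Ioi (0 : ℝ)).indicator (1 : ℝ → ℝ) (x - l⁻¹ * w) * fejer w)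
      atTop (𝓝 (∫ w, fejer w)) := by
    refine tendsto_integral_filter_of_dominated_convergence fejer (.of_forall fun x ↦ ?_)
      (.of_forall fun x ↦ .of_forall fun w ↦ ?_) integrable_fejer (.of_forall fun w ↦ ?_)
    · exact ((((measurable_one.indicator measurableSet_Ioi).comp
        (by fun_prop : Measurable fun w : ℝ ↦ x - l⁻¹ * w))).mul
        continuous_fejer.measurable).aestronglyMeasurable
    · rw [norm_mul, Real.norm_of_nonneg (fejer_nonneg w)]
      refine mul_le_of_le_one_left (fejer_nonneg w) ?_
      simp only [indicator]
      split_ifs <;> simp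
    · refine tendsto_const_nhds.congr' ?_
      filter_upwards [eventually_gt_atTop (l⁻¹ * w)] with x hx
      rw [indicator_of_mem (by simpa using hx)]
      simp
  have h2 := (h.const_mul l).add hind
  rw [mul_zero, zero_add] at h2
  refine h2.congr fun x ↦ ?_
  have hi1 : Integrable fun w ↦ (Ioi (0 : ℝ)).indicator (fun u ↦ B u - 1) (x - l⁻¹ * w) *
      fejer w := by
    refine integrable_fejer.bdd_mul (c := C + 1) ?_ (.of_forall fun w ↦ ?_)
    · exact (((hBm.sub_const 1).indicator measurableSet_Ioi).comp
        (by fun_prop : Measurable fun w : ℝ ↦ x - l⁻¹ * w)).aestronglyMeasurable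
    · have h0 := hB0 (x - l⁻¹ * w)
      have h1 := hBC (x - l⁻¹ * w)
      rw [Real.norm_eq_abs, abs_le]
      simp only [indicator]
      split_ifs <;> constructor <;> linarith
  have hi2 : Integrable fun w ↦ (Ioi (0 : ℝ)).indicator (1 : ℝ → ℝ) (x - l⁻¹ * w) *
      fejer w := by
    refine integrable_fejer.bdd_mul (c := 1) ?_ (.of_forall fun w ↦ ?_)
    · exact ((measurable_one.indicator measurableSet_Ioi).comp
        (by fun_prop : Measurable fun w : ℝ ↦ x - l⁻¹ * w)).aestronglyMeasurable
    · simp only [indicator]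
      split_ifs <;> simp
  rw [setIntegral_mul_fejer _ hl, mul_inv_cancel_left₀ hl.ne', ← integral_add hi1 hi2]
  refine integral_congr_ae (.of_forall fun w ↦ ?_)
  simp only [indicator, Pi.one_apply]
  split_ifs with hw
  · ring
  · rw [hBz _ (by simpa using hw)]
    ring

/-- A slowly decreasing bounded function whose Fejér averages tend to `1` tends to `1`. -/
theorem tendsto_one_of_fejer {B : ℝ → ℝ} {C : ℝ} (hmono : Monotone fun u ↦ Real.exp u * B u)
    (hB0 : ∀ u, 0 ≤ B u) (hBC : ∀ u, B u ≤ C) (hBz : ∀ u ≤ 0, B u = 0)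
    (h : ∀ l > 0, Tendsto (fun x ↦ ∫ u in Ioi (0 : ℝ), (B u - 1) * fejer (l * (x - u)))
      atTop (𝓝 0)) :
    Tendsto B atTop (𝓝 1) := by
  have hBm : Measurable B := by
    have : B = fun u ↦ Real.exp (-u) * (Real.exp u * B u) := by
      funext u
      rw [← mul_assoc, ← Real.exp_add]
      simp
    rw [this]
    exact (by fun_prop : Measurable fun u : ℝ ↦ Real.exp (-u)).mul hmono.measurable
  have hBle {u v d : ℝ} (huv : u ≤ v) (hd : v ≤ u + d) : B u ≤ Real.exp d * B v := by
    have h1 := mul_le_mul_of_nonneg_left (hmono huv) (Real.exp_nonneg (-u))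
    simp only [← mul_assoc, ← Real.exp_add] at h1
    rw [neg_add_cancel, Real.exp_zero, one_mul] at h1
    refine h1.trans (mul_le_mul_of_nonneg_right (Real.exp_le_exp.2 (by linarith)) (hB0 v))
  set κ := ∫ w, fejer w with hκ
  have hκ0 : 0 < κ := integral_fejer_pos
  set A : ℝ → ℝ := fun R ↦ ∫ w in -R..R, fejer w with hA
  have hAlim : Tendsto A atTop (𝓝 κ) :=
    intervalIntegral_tendsto_integral integrable_fejer tendsto_neg_atTop_atBot tendsto_id
  set F : ℝ → ℝ → ℝ := fun l x ↦ ∫ w, B (x - l⁻¹ * w) * fejer w with hF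
  have hFlim (l : ℝ) (hl : 0 < l) : Tendsto (F l) atTop (𝓝 κ) :=
    tendsto_integral_comp_mul_fejer hBm hB0 hBC hBz hl (h l hl)
  have hinteg (l x : ℝ) : Integrable fun w ↦ B (x - l⁻¹ * w) * fejer w := by
    refine integrable_fejer.bdd_mul (c := C) (hBm.comp
      (by fun_prop : Measurable fun w : ℝ ↦ x - l⁻¹ * w)).aestronglyMeasurable
      (.of_forall fun w ↦ ?_)
    rw [Real.norm_of_nonneg (hB0 _)]
    exact hBC _
  have hwd {R w : ℝ} (hR : 0 < R) (hw : w ∈ Ioc (-R) R) :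
      -R⁻¹ ≤ (R ^ 2)⁻¹ * w ∧ (R ^ 2)⁻¹ * w ≤ R⁻¹ := by
    have h1 : (R ^ 2)⁻¹ * R = R⁻¹ := by field_simp
    have h2 : 0 < (R ^ 2)⁻¹ := by positivity
    constructor <;> nlinarith [hw.1, hw.2]
  have hAset (R : ℝ) (hR : 0 < R) : A R = ∫ w in Ioc (-R) R, fejer w :=
    intervalIntegral.integral_of_le (by linarith)
  have hupper (R : ℝ) (hR : 0 < R) (x : ℝ) :
      B x * A R ≤ Real.exp (2 * R⁻¹) * F (R ^ 2) (x + R⁻¹) := by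
    calc B x * A R = ∫ w in Ioc (-R) R, B x * fejer w := by
          rw [hAset R hR, integral_const_mul]
      _ ≤ ∫ w in Ioc (-R) R,
            Real.exp (2 * R⁻¹) * (B (x + R⁻¹ - (R ^ 2)⁻¹ * w) * fejer w) := by
          refine setIntegral_mono_on (integrable_fejer.const_mul _).integrableOn
            ((hinteg _ _).const_mul _).integrableOn measurableSet_Ioc fun w hw ↦ ?_
          rw [← mul_assoc]
          obtain ⟨h1, h2⟩ := hwd hR hw
          exact mul_le_mul_of_nonneg_right (hBle (by linarith) (by linarith)) (fejer_nonneg w)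
      _ ≤ ∫ w, Real.exp (2 * R⁻¹) * (B (x + R⁻¹ - (R ^ 2)⁻¹ * w) * fejer w) :=
          setIntegral_le_integral ((hinteg _ _).const_mul _) (.of_forall fun w ↦
            mul_nonneg (Real.exp_nonneg _) (mul_nonneg (hB0 _) (fejer_nonneg w)))
      _ = _ := integral_const_mul _ _
  have hlower (R : ℝ) (hR : 0 < R) (x : ℝ) :
      F (R ^ 2) (x - R⁻¹) ≤ Real.exp (2 * R⁻¹) * B x * A R + C * (κ - A R) := by
    have hsplit := integral_add_compl (measurableSet_Ioc (a := -R) (b := R)) integrable_fejer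
    calc F (R ^ 2) (x - R⁻¹) = (∫ w in Ioc (-R) R, B (x - R⁻¹ - (R ^ 2)⁻¹ * w) * fejer w) +
            ∫ w in (Ioc (-R) R)ᶜ, B (x - R⁻¹ - (R ^ 2)⁻¹ * w) * fejer w :=
          (integral_add_compl measurableSet_Ioc (hinteg _ _)).symm
      _ ≤ (∫ w in Ioc (-R) R, Real.exp (2 * R⁻¹) * B x * fejer w) +
            ∫ w in (Ioc (-R) R)ᶜ, C * fejer w := by
          refine add_le_add (setIntegral_mono_on (hinteg _ _).integrableOn
            (integrable_fejer.const_mul _).integrableOn measurableSet_Ioc fun w hw ↦ ?_)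
            (setIntegral_mono_on (hinteg _ _).integrableOn
            (integrable_fejer.const_mul _).integrableOn measurableSet_Ioc.compl fun w hw ↦
            mul_le_mul_of_nonneg_right (hBC _) (fejer_nonneg w))
          obtain ⟨h1, h2⟩ := hwd hR hw
          exact mul_le_mul_of_nonneg_right (hBle (by linarith) (by linarith)) (fejer_nonneg w)
      _ = _ := by
          rw [integral_const_mul, integral_const_mul, hAset R hR, hκ, ← hsplit]
          ring
  have hinv : Tendsto (fun R : ℝ ↦ 2 * R⁻¹) atTop (𝓝 0) := by
    simpa using tendsto_inv_atTop_zero.const_mul (2 : ℝ)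
  have hexp : Tendsto (fun R : ℝ ↦ Real.exp (2 * R⁻¹)) atTop (𝓝 1) := by
    simpa [Function.comp_def] using (Real.continuous_exp.tendsto 0).comp hinv
  refine tendsto_order.2 ⟨fun a ha ↦ ?_, fun a ha ↦ ?_⟩
  · have hlim : Tendsto (fun R ↦ Real.exp (2 * R⁻¹) * a * A R + C * (κ - A R)) atTop
        (𝓝 (1 * a * κ + C * (κ - κ))) :=
      ((hexp.mul_const a).mul hAlim).add ((tendsto_const_nhds.sub hAlim).const_mul C)
    have hlt : 1 * a * κ + C * (κ - κ) < κ := by nlinarith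
    obtain ⟨R, hR, hR0, hRA⟩ := ((hlim.eventually_lt_const hlt).and
      ((eventually_gt_atTop 0).and (hAlim.eventually_const_lt hκ0))).exists
    have hx := ((hFlim (R ^ 2) (by positivity)).comp
      (tendsto_atTop_add_const_right atTop (-R⁻¹) tendsto_id)).eventually_const_lt hR
    filter_upwards [hx] with x hx
    have hx' := hx.trans_le (hlower R hR0 x)
    by_contra! hle
    have : Real.exp (2 * R⁻¹) * B x * A R ≤ Real.exp (2 * R⁻¹) * a * A R := by gcongr
    linarith
  · have hlim : Tendsto (fun R ↦ a * A R * Real.exp (-(2 * R⁻¹))) atTop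
        (𝓝 (a * κ * Real.exp (-0))) :=
      (hAlim.const_mul a).mul ((Real.continuous_exp.tendsto _).comp hinv.neg)
    have hlt : κ < a * κ * Real.exp (-0) := by
      rw [neg_zero, Real.exp_zero]
      nlinarith
    obtain ⟨R, hR, hR0, hRA⟩ := ((hlim.eventually_const_lt hlt).and
      ((eventually_gt_atTop 0).and (hAlim.eventually_const_lt hκ0))).exists
    have hx := ((hFlim (R ^ 2) (by positivity)).comp
      (tendsto_atTop_add_const_right atTop R⁻¹ tendsto_id)).eventually_lt_const hR
    filter_upwards [hx] with x hx
    have h1 := hupper R hR0 x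
    have h2 := mul_lt_mul_of_pos_left hx (Real.exp_pos (2 * R⁻¹))
    have h3 : Real.exp (2 * R⁻¹) * (a * A R * Real.exp (-(2 * R⁻¹))) = a * A R := by
      rw [Real.exp_neg]
      field_simp
    rw [h3] at h2
    exact lt_of_mul_lt_mul_right (h1.trans_lt h2) hRA.le

/-- The normalised Chebyshev function in the variable `log x`. -/
noncomputable def expPsi (u : ℝ) : ℝ := Real.exp (-u) * Chebyshev.psi (Real.exp u)

theorem expPsi_nonneg (u : ℝ) : 0 ≤ expPsi u :=
  mul_nonneg (Real.exp_nonneg _) (Chebyshev.psi_nonneg _)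

theorem exp_mul_expPsi (u : ℝ) : Real.exp u * expPsi u = Chebyshev.psi (Real.exp u) := by
  rw [expPsi, ← mul_assoc, ← Real.exp_add, add_neg_cancel, Real.exp_zero, one_mul]

theorem expPsi_le (u : ℝ) : expPsi u ≤ Real.log 4 + 4 := by
  have h := Chebyshev.psi_le_const_mul_self (Real.exp_nonneg u)
  rw [← exp_mul_expPsi, mul_comm] at h
  exact le_of_mul_le_mul_right h (Real.exp_pos u)

theorem measurable_expPsi : Measurable expPsi :=
  (by fun_prop : Measurable fun u : ℝ ↦ Real.exp (-u)).mul
    (Chebyshev.psi_mono.measurable.comp Real.measurable_exp)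

/-- The L-series of the von Mangoldt function as a Laplace transform. -/
theorem LSeries_vonMangoldt_eq_laplace {s : ℂ} (hs : 0 < s.re) :
    LSeries (fun n ↦ (ArithmeticFunction.vonMangoldt n : ℂ)) (1 + s) =
      (1 + s) * ∫ u in Ioi (0 : ℝ), (expPsi u : ℂ) * Complex.exp (-s * u) := by
  have hsum (x : ℝ) : ∑ k ∈ Finset.Icc 1 ⌊x⌋₊, ArithmeticFunction.vonMangoldt k =
      Chebyshev.psi x := rfl
  have hO : (fun n : ℕ ↦ ∑ k ∈ Finset.Icc 1 n, ArithmeticFunction.vonMangoldt k) =O[atTop]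
      fun n ↦ (n : ℝ) ^ (1 : ℝ) := by
    refine Asymptotics.IsBigO.of_bound (Real.log 4 + 4) (.of_forall fun n ↦ ?_)
    have h := hsum n
    rw [Nat.floor_natCast] at h
    rw [h, Real.rpow_one, Real.norm_of_nonneg (Chebyshev.psi_nonneg _), Real.norm_natCast]
    exact Chebyshev.psi_le_const_mul_self n.cast_nonneg
  rw [LSeries_eq_mul_integral_of_nonneg _ zero_le_one (by simpa using hs) hO
    fun n ↦ ArithmeticFunction.vonMangoldt_nonneg, ← Real.exp_zero, ← integral_comp_exp_Ioi]
  congr 1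
  refine integral_congr_ae (.of_forall fun u ↦ ?_)
  beta_reduce
  rw [← Complex.ofReal_sum, hsum, ← exp_mul_expPsi,
    Complex.cpow_def_of_ne_zero (by simp), ← Complex.ofReal_log (Real.exp_nonneg u), Real.log_exp,
    Complex.real_smul]
  push_cast
  have : Complex.exp (-s * u) = Complex.exp u * Complex.exp u *
      Complex.exp (u * -(1 + s + 1)) := by
    rw [← Complex.exp_add, ← Complex.exp_add]
    ring_nf
  rw [this]
  ring

/-- The prime number theorem in the form `ψ (e ^ u) ~ e ^ u`. -/
theorem tendsto_expPsi : Tendsto expPsi atTop (𝓝 1) := by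
  have hlog4 : 0 ≤ Real.log 4 := Real.log_nonneg (by norm_num)
  refine tendsto_one_of_fejer (C := Real.log 4 + 4) ?_ expPsi_nonneg expPsi_le (fun u hu ↦ ?_)
    fun l hl ↦ ?_
  · simp only [exp_mul_expPsi]
    exact Chebyshev.psi_mono.comp Real.exp_monotone
  · rw [expPsi, Chebyshev.psi_eq_zero_of_le_one (Real.exp_le_one_iff.2 hu), mul_zero]
  set Aux := ArithmeticFunction.vonMangoldt.LFunctionResidueClassAux (1 : ZMod 1) with hAux
  refine tendsto_integral_mul_fejer (C := Real.log 4 + 5) (G := fun s ↦ (Aux (1 + s) - 1) / (1 + s))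
    (measurable_expPsi.sub_const 1) (fun u ↦ ?_) ?_ (fun s hs ↦ ?_) hl
  · have h1 := expPsi_nonneg u
    have h2 := expPsi_le u
    rw [abs_le]
    constructor <;> linarith
  · have hshift : ContinuousOn (fun s : ℂ ↦ Aux (1 + s)) {s | 0 ≤ s.re} :=
      (ArithmeticFunction.vonMangoldt.continuousOn_LFunctionResidueClassAux (1 : ZMod 1)).comp
        (by fun_prop) fun s hs ↦ by simpa using hs
    refine (hshift.sub continuousOn_const).div (by fun_prop) fun s hs h ↦ ?_
    have := congrArg Complex.re h
    simp only [Complex.add_re, Complex.one_re, Complex.zero_re] at this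
    have hs' : 0 ≤ s.re := hs
    linarith
  · have hs0 : s ≠ 0 := fun h ↦ by simp [h] at hs
    have hs1 : 1 + s ≠ 0 := fun h ↦ by
      have := congrArg Complex.re h
      simp only [Complex.add_re, Complex.one_re, Complex.zero_re] at this
      linarith
    have hA : Aux (1 + s) =
        LSeries (fun n ↦ (ArithmeticFunction.vonMangoldt n : ℂ)) (1 + s) - 1 / s := by
      rw [hAux, ArithmeticFunction.vonMangoldt.eqOn_LFunctionResidueClassAux (isUnit_one)
        (show 1 < (1 + s).re by simpa using hs)]
      have : ArithmeticFunction.vonMangoldt.residueClass (1 : ZMod 1) =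
          ArithmeticFunction.vonMangoldt := by
        funext n
        exact indicator_of_mem (s := {n : ℕ | (n : ZMod 1) = 1})
          (Subsingleton.elim (n : ZMod 1) 1) _
      rw [this]
      simp
    have hexp : ∫ u in Ioi (0 : ℝ), Complex.exp (-s * u) = 1 / s := by
      rw [integral_exp_mul_complex_Ioi (by simpa using hs)]
      simp
    have hi : IntegrableOn (fun u : ℝ ↦ Complex.exp (-s * u)) (Ioi 0) :=
      integrableOn_exp_mul_complex_Ioi (by simpa using hs) 0
    have hi' : IntegrableOn (fun u : ℝ ↦ (expPsi u : ℂ) * Complex.exp (-s * u)) (Ioi 0) := by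
      refine hi.bdd_mul (c := Real.log 4 + 4)
        (Complex.measurable_ofReal.comp measurable_expPsi).aestronglyMeasurable
        (.of_forall fun u ↦ ?_)
      rw [Complex.norm_real, Real.norm_of_nonneg (expPsi_nonneg u)]
      exact expPsi_le u
    push_cast
    simp only [sub_mul, one_mul]
    rw [integral_sub hi' hi, hexp, hA, LSeries_vonMangoldt_eq_laplace hs]
    field_simp
    ring

/-- The prime number theorem for the Chebyshev function `θ`. -/
theorem tendsto_theta_div : Tendsto (fun x ↦ Chebyshev.theta x / x) atTop (𝓝 1) := by
  have hpsi : Tendsto (fun x ↦ Chebyshev.psi x / x) atTop (𝓝 1) := by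
    refine (tendsto_expPsi.comp Real.tendsto_log_atTop).congr' ?_
    filter_upwards [eventually_gt_atTop 0] with x hx
    rw [Function.comp, expPsi, Real.exp_neg, Real.exp_log hx]
    ring
  have hdiff : Tendsto (fun x ↦ (Chebyshev.psi - Chebyshev.theta) x / x) atTop (𝓝 0) := by
    refine (Chebyshev.isBigO_psi_sub_theta_sqrt.trans_isLittleO ?_).tendsto_div_nhds_zero
    refine Asymptotics.isLittleO_of_tendsto' ?_ ?_
    · filter_upwards [eventually_ne_atTop 0] with x hx h using absurd h hx
    · refine (Real.tendsto_sqrt_atTop.inv_tendsto_atTop).congr' ?_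
      filter_upwards [eventually_gt_atTop 0] with x hx
      rw [Pi.inv_apply, Real.sqrt_div_self']
      simp
  have h := hpsi.sub hdiff
  rw [sub_zero] at h
  refine h.congr fun x ↦ ?_
  rw [Pi.sub_apply]
  ring

/-- The prime number theorem. -/
theorem tendsto_primeCounting_mul_log_div :
    Tendsto (fun x : ℝ ↦ Nat.primeCounting ⌊x⌋₊ * Real.log x / x) atTop (𝓝 1) := by
  have hO : (fun x ↦ Nat.primeCounting ⌊x⌋₊ - Chebyshev.theta x / Real.log x) =o[atTop]
      fun x ↦ x / Real.log x := by
    refine Chebyshev.primeCounting_sub_theta_div_log_isBigO.trans_isLittleO ?_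
    have h1 : (fun x : ℝ ↦ (Real.log x)⁻¹) =o[atTop] fun _ ↦ (1 : ℝ) :=
      (Asymptotics.isLittleO_one_iff ℝ).2 Real.tendsto_log_atTop.inv_tendsto_atTop
    refine ((Asymptotics.isBigO_refl (fun x : ℝ ↦ x / Real.log x) atTop).mul_isLittleO h1).congr
      (fun x ↦ ?_) fun x ↦ mul_one _
    ring
  have h := tendsto_theta_div.add hO.tendsto_div_nhds_zero
  rw [add_zero] at h
  refine h.congr' ?_
  filter_upwards [eventually_gt_atTop 1] with x hx
  have := Real.log_pos hx
  have : 0 < x := by linarith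
  field_simp
  ring

end WienerIkehara

section

open Filter Topology

/-- Regularity of the prime counting function under dilations, uniformly in the dilation factor. -/
theorem eventually_mul_primeCounting_le {η : ℝ} (hη : 0 < η) (hη1 : η ≤ 1) :
    ∀ᶠ y : ℝ in atTop, ∀ t ∈ Set.Icc η 5,
      t * Nat.primeCounting ⌊y⌋₊ ≤ (1 + η) * Nat.primeCounting ⌊t * y⌋₊ := by
  set δ := η / 8 with hδ
  have hδ0 : 0 < δ := by positivity
  have hlow := WienerIkehara.tendsto_primeCounting_mul_log_div.eventually_const_le
    (show 1 - δ < 1 by linarith)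
  have hupp := WienerIkehara.tendsto_primeCounting_mul_log_div.eventually_le_const
    (show 1 < 1 + δ by linarith)
  obtain ⟨X, hX⟩ := eventually_atTop.1 hlow
  filter_upwards [hupp, (tendsto_id.const_mul_atTop hη).eventually_ge_atTop (max X 2),
    eventually_ge_atTop 2, (Real.tendsto_log_atTop.const_mul_atTop hδ0).eventually_ge_atTop
      (Real.log 5)] with y hy hηy hy2 hlog t ht
  have hty : max X 2 ≤ t * y :=
    hηy.trans (mul_le_mul_of_nonneg_right ht.1 (show 0 ≤ y by linarith))
  have hty2 : 2 ≤ t * y := (le_max_right _ _).trans hty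
  have ht0 : 0 < t := hη.trans_le ht.1
  have h1 := hX _ ((le_max_left _ _).trans hty)
  have hl : 0 < Real.log y := Real.log_pos (by linarith)
  have hlty : Real.log (t * y) ≤ (1 + δ) * Real.log y := by
    rw [Real.log_mul (by linarith) (by linarith)]
    have : Real.log t ≤ Real.log 5 := Real.log_le_log ht0 ht.2
    linarith
  rw [le_div_iff₀ (by linarith)] at h1
  rw [div_le_iff₀ (by linarith)] at hy
  set k : ℝ := (Nat.primeCounting ⌊y⌋₊ : ℝ)
  set p : ℝ := (Nat.primeCounting ⌊t * y⌋₊ : ℝ)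
  have hp : 0 ≤ p := Nat.cast_nonneg _
  have h2 : (1 - δ) * (t * y) ≤ p * ((1 + δ) * Real.log y) :=
    h1.trans (mul_le_mul_of_nonneg_left hlty hp)
  have hδ1 : 0 < 1 - δ := by linarith
  have h3 : (1 - δ) * (t * (k * Real.log y)) ≤ (1 + δ) * (p * ((1 + δ) * Real.log y)) := by
    calc _ ≤ (1 - δ) * (t * ((1 + δ) * y)) := by gcongr
      _ = (1 + δ) * ((1 - δ) * (t * y)) := by ring
      _ ≤ _ := by gcongr
  have h4 : (1 + δ) * (1 + δ) ≤ (1 - δ) * (1 + η) := by nlinarith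
  have h5 : (1 - δ) * Real.log y * (t * k) ≤ (1 - δ) * Real.log y * ((1 + η) * p) := by
    calc _ = (1 - δ) * (t * (k * Real.log y)) := by ring
      _ ≤ _ := h3
      _ = (1 + δ) * (1 + δ) * (p * Real.log y) := by ring
      _ ≤ (1 - δ) * (1 + η) * (p * Real.log y) := by gcongr
      _ = _ := by ring
  exact le_of_mul_le_mul_left h5 (by positivity)

theorem nth_prime_le_of_lt_primeCounting {n : ℕ} {z : ℝ} (hz : 0 ≤ z)
    (h : n < Nat.primeCounting ⌊z⌋₊) : (Nat.nth Nat.Prime n : ℝ) ≤ z :=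
  (Nat.le_floor_iff hz).1 (Nat.le_of_lt_succ (Nat.nth_lt_of_lt_count h))

/-- Prime numbers are asymptotically equidistributed below a constant multiple of `y`. -/
theorem eventually_nth_prime_le {η : ℝ} (hη : 0 < η) (hη1 : η ≤ 1) :
    ∀ᶠ y : ℝ in atTop, ∀ n < 2 * Nat.primeCounting ⌊y⌋₊, (Nat.nth Nat.Prime n : ℝ) ≤
      ((1 + η) * ((n + 1) / Nat.primeCounting ⌊y⌋₊) + η) * y := by
  filter_upwards [eventually_mul_primeCounting_le hη hη1, eventually_ge_atTop 0] with y hy hy0 n hn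
  have hk : (0 : ℝ) < Nat.primeCounting ⌊y⌋₊ := by
    have : 0 < Nat.primeCounting ⌊y⌋₊ := by omega
    exact_mod_cast this
  have hn' : (n + 1 : ℝ) ≤ 2 * Nat.primeCounting ⌊y⌋₊ := by exact_mod_cast hn
  set k : ℝ := (Nat.primeCounting ⌊y⌋₊ : ℝ)
  set t : ℝ := (1 + η) * ((n + 1) / k) + η with ht
  have h2 : (n + 1) / k ≤ 2 := (div_le_iff₀ hk).2 hn'
  have h0 : 0 ≤ (n + 1) / k := by positivity
  have h := hy t ⟨by rw [ht]; nlinarith, by rw [ht]; nlinarith⟩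
  have h3 : t * k = (1 + η) * (n + 1) + η * k := by
    rw [ht]
    field_simp
  refine nth_prime_le_of_lt_primeCounting (by positivity) ?_
  have h4 : (1 + η) * (n : ℝ) < (1 + η) * Nat.primeCounting ⌊t * y⌋₊ := by
    have : 0 < η * k := by positivity
    linarith
  exact_mod_cast lt_of_mul_lt_mul_left h4 (by linarith)

end

theorem primePi_eq_primeCounting {x : ℝ} (hx : 0 ≤ x) : primePi x = Nat.primeCounting ⌊x⌋₊ := by
  rw [Nat.primeCounting, Nat.primeCounting', Nat.count_eq_card_filter_range, primePi,
    ← Set.ncard_coe_finset]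
  congr 1
  ext p
  simp [Nat.le_floor_iff hx, and_comm]

/-- The lower bound `π(N) + (1 / 2 - e) π(√N)` for large `N`, from disjoint triples of primes whose
pairwise products are at most `N`. -/
theorem exists_primeCounting_add_le_maxSqfreeDSP {e : ℝ} (he : 0 < e) (he1 : e ≤ 1) :
    ∃ N₀ : ℕ, ∀ N : ℕ, N₀ ≤ N → (Nat.primeCounting N : ℝ) +
      (1 / 2 - e) * Nat.primeCounting ⌊√(N : ℝ)⌋₊ ≤ maxSqfreeDSP N := by
  set η := e / 16 with hη
  have hη0 : 0 < η := by positivity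
  have hlarge : ∀ᶠ y : ℝ in Filter.atTop, η⁻¹ ≤ (Nat.primeCounting ⌊y⌋₊ : ℝ) :=
    (tendsto_natCast_atTop_atTop.comp (Nat.tendsto_primeCounting.comp
      tendsto_nat_floor_atTop)).eventually_ge_atTop _
  have hev := (Real.tendsto_sqrt_atTop.comp tendsto_natCast_atTop_atTop).eventually
    (hlarge.and (eventually_nth_prime_le hη0 (by linarith)))
  obtain ⟨N₀, hN₀⟩ := Filter.eventually_atTop.1 hev
  refine ⟨N₀, fun N hN ↦ ?_⟩
  obtain ⟨hk, hnth⟩ := hN₀ N hN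
  simp only [Function.comp] at hk hnth
  have hy2 : √(N : ℝ) * √(N : ℝ) = N := Real.mul_self_sqrt N.cast_nonneg
  have hy0 := Real.sqrt_nonneg (N : ℝ)
  set y := √(N : ℝ) with hy
  set k := Nat.primeCounting ⌊y⌋₊ with hkdef
  have hηk : 1 ≤ η * k := by
    rwa [inv_le_iff_one_le_mul₀ hη0, mul_comm] at hk
  have hk0 : (0 : ℝ) < k := pos_of_mul_pos_right (by linarith : 0 < η * k) hη0.le
  set M := ⌊(1 / 2 - e / 2) * k⌋₊ with hM
  have hM1 : (1 / 2 - e) * k ≤ M := by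
    have := Nat.lt_floor_add_one ((1 / 2 - e / 2) * (k : ℝ))
    rw [← hM] at this
    nlinarith
  have hM2 : (M : ℝ) ≤ (1 / 2 - e / 2) * k :=
    Nat.floor_le (mul_nonneg (by linarith) hk0.le)
  have hM3 : 2 * M ≤ k := by
    have : (2 * M : ℝ) ≤ k := by nlinarith
    exact_mod_cast this
  have hsmall (n : ℕ) (hn : n < k) : (Nat.nth Nat.Prime n : ℝ) ≤ y :=
    nth_prime_le_of_lt_primeCounting hy0 hn
  have hinj := Nat.nth_injective Nat.infinite_setOfPred_prime
  have hcross (i n : ℕ) (hi : i < M) (hn : n + 1 ≤ 2 * M - 2 * i) :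
      Nat.nth Nat.Prime n * Nat.nth Nat.Prime (k + i) ≤ N := by
    have hn' : (n : ℝ) + 1 ≤ 2 * M - 2 * i := by
      have : n + 1 + 2 * i ≤ 2 * M := by omega
      have : (n : ℝ) + 1 + 2 * i ≤ 2 * M := by exact_mod_cast this
      linarith
    have h1 := hnth n (by omega)
    have h2 := hnth (k + i) (by omega)
    have hs0 : (0 : ℝ) ≤ i / k := by positivity
    have hn1 : (n + 1 : ℝ) / k ≤ 1 - e - 2 * (i / k) := by
      rw [div_le_iff₀ hk0, sub_mul, mul_assoc, div_mul_cancel₀ _ hk0.ne']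
      linarith
    have hq1 : ((k + i : ℕ) + 1 : ℝ) / k ≤ 1 + i / k + η := by
      rw [div_le_iff₀ hk0, add_mul, add_mul, div_mul_cancel₀ _ hk0.ne']
      push_cast
      linarith
    have hn0 : 0 ≤ (n + 1 : ℝ) / k := by positivity
    have hq0 : 0 ≤ ((k + i : ℕ) + 1 : ℝ) / k := by positivity
    set s : ℝ := i / k
    have hf1 : (1 + η) * ((n + 1 : ℝ) / k) + η ≤ 1 - 2 * s - 14 * η := by nlinarith
    have hf2 : (1 + η) * (((k + i : ℕ) + 1 : ℝ) / k) + η ≤ 1 + s + 5 * η := by nlinarith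
    have hf0 : 0 ≤ (1 + η) * ((n + 1 : ℝ) / k) + η := by positivity
    have hprod : (Nat.nth Nat.Prime n : ℝ) * Nat.nth Nat.Prime (k + i) ≤ N := by
      calc _ ≤ ((1 - 2 * s - 14 * η) * y) * ((1 + s + 5 * η) * y) :=
            mul_le_mul (h1.trans (mul_le_mul_of_nonneg_right hf1 hy0))
              (h2.trans (mul_le_mul_of_nonneg_right hf2 hy0)) (Nat.cast_nonneg _)
              (mul_nonneg (hf0.trans hf1) hy0)
        _ = ((1 - 2 * s - 14 * η) * (1 + s + 5 * η)) * (y * y) := by ring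
        _ ≤ 1 * (y * y) := by
            refine mul_le_mul_of_nonneg_right ?_ (by positivity)
            nlinarith [mul_nonneg hs0 hη0.le, mul_nonneg hs0 hs0, mul_nonneg hη0.le hη0.le]
        _ = N := by rw [one_mul, hy2]
    exact_mod_cast hprod
  have hmain : Nat.primeCounting N + M ≤ maxSqfreeDSP N := by
    refine primeCounting_add_le_maxSqfreeDSP (fun i ↦ Nat.nth Nat.Prime (2 * M - 1 - 2 * i))
      (fun i ↦ Nat.nth Nat.Prime (2 * M - 2 - 2 * i)) (fun i ↦ Nat.nth Nat.Prime (k + i))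
      (fun i _ ↦ Nat.prime_nth_prime _) (fun i _ ↦ Nat.prime_nth_prime _)
      (fun i _ ↦ Nat.prime_nth_prime _) (fun i hi j hj h ↦ ?_) (fun i hi j hj h ↦ ?_)
      (fun i hi j hj h ↦ ?_) (fun i hi j hj h ↦ ?_) (fun i hi j hj h ↦ ?_)
      (fun i hi j hj h ↦ ?_) (fun i hi ↦ ?_) (fun i hi ↦ hcross i _ hi (by omega))
      (fun i hi ↦ hcross i _ hi (by omega))
    any_goals
      have := hinj h
      omega
    have h1 := hsmall (2 * M - 1 - 2 * i) (by omega)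
    have h2 := hsmall (2 * M - 2 - 2 * i) (by omega)
    have := mul_le_mul h1 h2 (Nat.cast_nonneg _) hy0
    rw [hy2] at this
    exact_mod_cast this
  calc (Nat.primeCounting N : ℝ) + (1 / 2 - e) * k ≤ Nat.primeCounting N + M := by linarith
    _ ≤ maxSqfreeDSP N := by exact_mod_cast hmain

/-- `h(N) ≥ π(N) + (1/2)·π(N^{1/2}) − o(π(N^{1/2}))`. -/
theorem stmt4 : ∀ ε : ℝ, 0 < ε → ∃ N₀ : ℕ, ∀ N : ℕ, N₀ ≤ N →
    (maxSqfreeDSP N : ℝ) ≥ primePi N + (1 / 2) * primePi ((N : ℝ) ^ ((1 : ℝ) / 2)) -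
      ε * primePi ((N : ℝ) ^ ((1 : ℝ) / 2)) := by
  intro ε hε
  obtain ⟨N₀, h⟩ := exists_primeCounting_add_le_maxSqfreeDSP (lt_min hε one_pos) (min_le_right ε 1)
  refine ⟨N₀, fun N hN ↦ ?_⟩
  rw [← Real.sqrt_eq_rpow, primePi_eq_primeCounting N.cast_nonneg,
    primePi_eq_primeCounting (Real.sqrt_nonneg _), Nat.floor_natCast]
  have h1 := h N hN
  have h2 : min ε 1 * (Nat.primeCounting ⌊√(N : ℝ)⌋₊ : ℝ) ≤ ε * Nat.primeCounting ⌊√(N : ℝ)⌋₊ :=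
    mul_le_mul_of_nonneg_right (min_le_left _ _) (Nat.cast_nonneg _)
  linarith
end

section
/- For every ε > 0 there exists a constant C > 0 such that for all N ∈ ℕ and all A ⊆ [N] with distinct subset products, |A| ≤ π(N) + (1/2)·π(N^{1/2}) + (1/2)·|P_□| + C·N^{5/12+ε}, where P_□ = {p prime : N^{1/3} < p ≤ N^{1/2} and p² divides some a ∈ A}. -/
open scoped Classical in
/-- The number of ends of the edge `a` (with ends `s a` and `t a`) that are equal to `v`. -/
noncomputable def incidence {α V : Type*} (s t : α → V) (v : V) (a : α) : ℤ :=
  (if s a = v then 1 else 0) + (if t a = v then 1 else 0)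

/-- A nonzero `{-1, 0, 1}`-valued weight on at most `m` edges of `E` whose (unsigned) boundary
vanishes at every vertex. -/
def IsShortRelation {α V : Type*} (s t : α → V) (E : Finset α) (m : ℕ) (x : α → ℤ) : Prop :=
  (∀ a, |x a| ≤ 1) ∧ (∀ a, x a ≠ 0 → a ∈ E) ∧ (∃ a, x a ≠ 0) ∧
    (∀ v, ∑ a ∈ E, x a * incidence s t v a = 0) ∧ (E.filter (fun a => x a ≠ 0)).card ≤ m

theorem IsShortRelation.mono {α V : Type*} {s t : α → V} {E F : Finset α} {m : ℕ} {x : α → ℤ}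
    (h : IsShortRelation s t E m x) (hEF : E ⊆ F) : IsShortRelation s t F m x := by
  obtain ⟨h1, h2, h3, h4, h5⟩ := h
  refine ⟨h1, fun a ha => hEF (h2 a ha), h3, fun v => ?_, ?_⟩
  · rw [← h4 v]
    refine (Finset.sum_subset hEF fun a _ ha => ?_).symm
    have : x a = 0 := by
      by_contra hx
      exact ha (h2 a hx)
    rw [this, zero_mul]
  · refine le_trans (Finset.card_le_card fun a ha => ?_) h5
    rw [Finset.mem_filter] at ha ⊢
    exact ⟨h2 a ha.2, ha.2⟩

/-- A breadth-first search tree of height at most `r` spanning the vertex set `B`, in the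
multigraph with edge set `E` and ends `s`, `t`. -/
structure BFSTree {α V : Type*} (s t : α → V) (E : Finset α) (B : Finset V) (r : ℕ) where
  /-- the root of the tree -/
  root : V
  /-- the distance to the root -/
  depth : V → ℕ
  /-- the parent of a vertex -/
  par : V → V
  /-- the edge joining a vertex to its parent -/
  edge : V → α
  root_mem : root ∈ B
  par_root : par root = root
  depth_root : depth root = 0
  par_mem : ∀ v ∈ B, par v ∈ B
  depth_par : ∀ v ∈ B, v ≠ root → depth (par v) + 1 = depth v
  edge_mem : ∀ v ∈ B, v ≠ root → edge v ∈ E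
  edge_ends : ∀ v ∈ B, v ≠ root →
    (s (edge v) = v ∧ t (edge v) = par v) ∨ (s (edge v) = par v ∧ t (edge v) = v)
  depth_le : ∀ v ∈ B, depth v ≤ r
  depth_ends : ∀ a ∈ E, s a ∈ B → t a ∈ B →
    depth (s a) ≤ depth (t a) + 1 ∧ depth (t a) ≤ depth (s a) + 1

namespace BFSTree

variable {α V : Type*} {s t : α → V} {E : Finset α} {B : Finset V} {r : ℕ}

/-- `w` is an ancestor of `v`, or `v` itself. -/
def Anc (T : BFSTree s t E B r) (w v : V) : Prop := ∃ i, T.par^[i] v = w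

theorem anc_refl (T : BFSTree s t E B r) (v : V) : T.Anc v v := ⟨0, rfl⟩

theorem Anc.trans {T : BFSTree s t E B r} {u v w : V} (h : T.Anc u v) (h' : T.Anc v w) :
    T.Anc u w := by
  obtain ⟨i, rfl⟩ := h
  obtain ⟨j, rfl⟩ := h'
  exact ⟨i + j, Function.iterate_add_apply _ _ _ _⟩

theorem anc_iff (T : BFSTree s t E B r) (w v : V) : T.Anc w v ↔ w = v ∨ T.Anc w (T.par v) := by
  constructor
  · rintro ⟨i, rfl⟩
    cases i with
    | zero => exact Or.inl rfl
    | succ i => exact Or.inr ⟨i, rfl⟩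
  · rintro (rfl | ⟨i, rfl⟩)
    · exact T.anc_refl _
    · exact ⟨i + 1, rfl⟩

theorem eq_root_of_depth (T : BFSTree s t E B r) {v : V} (hv : v ∈ B) (h : T.depth v = 0) :
    v = T.root := by
  by_contra hne
  have := T.depth_par v hv hne
  omega

theorem iterate_mem (T : BFSTree s t E B r) {v : V} (hv : v ∈ B) (i : ℕ) : T.par^[i] v ∈ B := by
  induction i with
  | zero => exact hv
  | succ i ih => rw [Function.iterate_succ_apply']; exact T.par_mem _ ih

theorem depth_par_eq (T : BFSTree s t E B r) {v : V} (hv : v ∈ B) :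
    T.depth (T.par v) = T.depth v - 1 := by
  by_cases h : v = T.root
  · rw [h, T.par_root, T.depth_root]
  · have := T.depth_par v hv h
    omega

theorem depth_iterate (T : BFSTree s t E B r) {v : V} (hv : v ∈ B) (i : ℕ) :
    T.depth (T.par^[i] v) = T.depth v - i := by
  induction i with
  | zero => rfl
  | succ i ih =>
    rw [Function.iterate_succ_apply', T.depth_par_eq (T.iterate_mem hv i), ih]
    omega

theorem Anc.depth_le {T : BFSTree s t E B r} {w v : V} (hv : v ∈ B) (h : T.Anc w v) :
    T.depth w ≤ T.depth v := by
  obtain ⟨i, rfl⟩ := h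
  rw [T.depth_iterate hv]
  omega

theorem Anc.eq_of_depth_eq {T : BFSTree s t E B r} {w v : V} (hv : v ∈ B) (h : T.Anc w v)
    (hd : T.depth w = T.depth v) : w = v := by
  obtain ⟨i, rfl⟩ := h
  rw [T.depth_iterate hv] at hd
  rcases Nat.eq_zero_or_pos i with rfl | hi
  · rfl
  · have h0 : T.depth v = 0 := by omega
    rw [T.eq_root_of_depth hv h0, Function.iterate_fixed T.par_root]

theorem anc_root_iff (T : BFSTree s t E B r) (w : V) : T.Anc w T.root ↔ w = T.root := by
  constructor
  · rintro ⟨i, rfl⟩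
    exact Function.iterate_fixed T.par_root i
  · rintro rfl
    exact T.anc_refl _

theorem edge_injOn (T : BFSTree s t E B r) {v w : V} (hv : v ∈ B) (hw : w ∈ B)
    (hv' : v ≠ T.root) (hw' : w ≠ T.root) (h : T.edge v = T.edge w) : v = w := by
  have h1 := T.edge_ends v hv hv'
  have h2 := T.edge_ends w hw hw'
  have h3 := T.depth_par v hv hv'
  have h4 := T.depth_par w hw hw'
  rw [h] at h1
  rcases h1 with ⟨a, b⟩ | ⟨a, b⟩ <;> rcases h2 with ⟨c, d⟩ | ⟨c, d⟩
  · rw [← a, c]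
  · have e1 : T.depth v = T.depth (T.par w) := by rw [← a, c]
    have e2 : T.depth w = T.depth (T.par v) := by rw [← b, d]
    omega
  · have e1 : T.depth w = T.depth (T.par v) := by rw [← a, c]
    have e2 : T.depth v = T.depth (T.par w) := by rw [← b, d]
    omega
  · rw [← b, d]

open scoped Classical in
/-- The alternating weight on the tree path from `v` to the root; the weight of the edge from `w`
to its parent is recorded at `w`. -/
noncomputable def stem (T : BFSTree s t E B r) (v w : V) : ℤ :=
  if T.Anc w v then (-1) ^ T.depth w else 0

open scoped Classical in
theorem stem_boundary (T : BFSTree s t E B r) (z : V) (n : ℕ) : ∀ v ∈ B, T.depth v = n →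
    ∑ w ∈ B.erase T.root, T.stem v w *
      ((if w = z then 1 else 0) + (if T.par w = z then 1 else 0)) =
      (-1) ^ n * (if v = z then 1 else 0) - (if T.root = z then 1 else 0) := by
  induction n with
  | zero =>
    intro v hv hd
    obtain rfl := T.eq_root_of_depth hv hd
    rw [Finset.sum_eq_zero]
    · simp
    · intro w hw
      rw [Finset.mem_erase] at hw
      rw [stem, if_neg (by rw [anc_root_iff]; exact hw.1), zero_mul]
  | succ n ih =>
    intro v hv hd
    have hne : v ≠ T.root := by
      rintro rfl
      rw [T.depth_root] at hd
      omega
    have hp := T.depth_par v hv hne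
    have hstem : ∀ w, T.stem v w = (if w = v then (-1) ^ (n + 1) else 0) + T.stem (T.par v) w := by
      intro w
      unfold stem
      by_cases hw : w = v
      · subst hw
        have : ¬ T.Anc w (T.par w) := fun h => by
          have := h.depth_le (T.par_mem w hv)
          omega
        simp [T.anc_refl, this, hd]
      · simp [T.anc_iff w v, hw]
    simp only [hstem, add_mul, Finset.sum_add_distrib]
    rw [ih (T.par v) (T.par_mem v hv) (by omega)]
    simp only [ite_mul, zero_mul]
    rw [Finset.sum_ite_eq', if_pos (Finset.mem_erase.2 ⟨hne, hv⟩)]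
    ring

open scoped Classical in
theorem card_anc_le (T : BFSTree s t E B r) {v : V} (hv : v ∈ B) :
    ((B.erase T.root).filter (fun w => T.Anc w v)).card ≤ r := by
  have hsub : (B.erase T.root).filter (fun w => T.Anc w v) ⊆
      (Finset.range (T.depth v)).image (fun i => T.par^[i] v) := by
    intro w hw
    rw [Finset.mem_filter, Finset.mem_erase] at hw
    obtain ⟨⟨hne, -⟩, i, rfl⟩ := hw
    refine Finset.mem_image.2 ⟨i, Finset.mem_range.2 ?_, rfl⟩
    by_contra hi
    exact hne (T.eq_root_of_depth (T.iterate_mem hv i) (by rw [T.depth_iterate hv]; omega))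
  calc _ ≤ _ := Finset.card_le_card hsub
    _ ≤ _ := Finset.card_image_le
    _ ≤ r := by rw [Finset.card_range]; exact T.depth_le v hv

open scoped Classical in
/-- Weights on the tree edges and on non-tree edges combine to a short relation. -/
theorem exists_isShortRelation (T : BFSTree s t E B r) {m : ℕ} (c : α → ℤ) (τ : V → ℤ)
    (hc : ∀ a, |c a| ≤ 1) (hcE : ∀ a, c a ≠ 0 → a ∈ E)
    (hcT : ∀ a, c a ≠ 0 → ∀ w ∈ B.erase T.root, T.edge w ≠ a) (hc0 : ∃ a, c a ≠ 0)
    (hτ : ∀ w ∈ B.erase T.root, |τ w| ≤ 1)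
    (hbd : ∀ z, ∑ a ∈ E, c a * incidence s t z a + ∑ w ∈ B.erase T.root, τ w *
      ((if w = z then 1 else 0) + (if T.par w = z then 1 else 0)) = 0)
    (hcard : (E.filter (fun a => c a ≠ 0)).card +
      ((B.erase T.root).filter (fun w => τ w ≠ 0)).card ≤ m) :
    ∃ x, IsShortRelation s t E m x := by
  set y : α → ℤ := fun a => ∑ w ∈ B.erase T.root, if T.edge w = a then τ w else 0 with hy
  have hy0 : ∀ a, (∀ w ∈ B.erase T.root, T.edge w ≠ a) → y a = 0 := fun a ha =>
    Finset.sum_eq_zero fun w hw => if_neg (ha w hw)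
  have hyT : ∀ w ∈ B.erase T.root, y (T.edge w) = τ w := by
    intro w hw
    have : ∀ u ∈ B.erase T.root, (if T.edge u = T.edge w then τ u else 0) =
        if u = w then τ u else 0 := by
      intro u hu
      rw [Finset.mem_erase] at hu hw
      by_cases huw : u = w
      · simp [huw]
      · rw [if_neg huw, if_neg fun h => huw (T.edge_injOn hu.2 hw.2 hu.1 hw.1 h)]
    rw [hy]
    simp only
    rw [Finset.sum_congr rfl this, Finset.sum_ite_eq', if_pos hw]
  have hcases : ∀ a, y a ≠ 0 → ∃ w ∈ B.erase T.root, T.edge w = a ∧ τ w ≠ 0 := by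
    intro a ha
    by_contra! hcon
    refine ha (Finset.sum_eq_zero fun w hw => ?_)
    split_ifs with h
    · exact hcon w hw h
    · rfl
  have hmem : ∀ w ∈ B.erase T.root, T.edge w ∈ E := fun w hw => by
    rw [Finset.mem_erase] at hw
    exact T.edge_mem w hw.2 hw.1
  refine ⟨fun a => c a + y a, fun a => ?_, fun a ha => ?_, ?_, fun z => ?_, ?_⟩
  · by_cases h : c a = 0
    · by_cases h' : y a = 0
      · simp [h, h']
      · obtain ⟨w, hw, rfl, -⟩ := hcases a h'
        simp only [h, zero_add, hyT w hw]
        exact hτ w hw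
    · simp only [hy0 a (hcT a h), add_zero]
      exact hc a
  · by_cases h : c a = 0
    · have h' : y a ≠ 0 := by simpa [h] using ha
      obtain ⟨w, hw, rfl, -⟩ := hcases a h'
      exact hmem w hw
    · exact hcE a h
  · obtain ⟨a, ha⟩ := hc0
    exact ⟨a, by simpa [hy0 a (hcT a ha)] using ha⟩
  · rw [← hbd z]
    simp only [add_mul, Finset.sum_add_distrib]
    congr 1
    simp only [hy, Finset.sum_mul]
    rw [Finset.sum_comm]
    refine Finset.sum_congr rfl fun w hw => ?_
    simp only [ite_mul, zero_mul]
    rw [Finset.sum_ite_eq, if_pos (hmem w hw)]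
    rw [Finset.mem_erase] at hw
    unfold incidence
    rcases T.edge_ends w hw.2 hw.1 with ⟨h1, h2⟩ | ⟨h1, h2⟩
    · rw [h1, h2]
    · rw [h1, h2, add_comm (if T.par w = z then (1 : ℤ) else 0)]
  · refine le_trans (le_trans (Finset.card_le_card (t := E.filter (fun a => c a ≠ 0) ∪
      ((B.erase T.root).filter (fun w => τ w ≠ 0)).image T.edge) ?_) ?_) hcard
    · intro a ha
      rw [Finset.mem_filter] at ha
      by_cases h : c a = 0
      · have h' : y a ≠ 0 := by simpa [h] using ha.2
        obtain ⟨w, hw, rfl, h0⟩ := hcases a h'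
        exact Finset.mem_union_right _ (Finset.mem_image_of_mem _ (Finset.mem_filter.2 ⟨hw, h0⟩))
      · exact Finset.mem_union_left _ (Finset.mem_filter.2 ⟨ha.1, h⟩)
    · exact (Finset.card_union_le _ _).trans (by gcongr; exact Finset.card_image_le)

open scoped Classical in
theorem stem_cases (T : BFSTree s t E B r) (v w : V) :
    (T.Anc w v ∧ T.stem v w = (-1) ^ T.depth w) ∨ (¬ T.Anc w v ∧ T.stem v w = 0) := by
  unfold stem
  by_cases h : T.Anc w v <;> simp [h]

open scoped Classical in
theorem card_stem_le (T : BFSTree s t E B r) {u v u' v' : V} (hu : u ∈ B) (hv : v ∈ B)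
    (hu' : u' ∈ B) (hv' : v' ∈ B) (τ : V → ℤ)
    (hτ : ∀ w, τ w ≠ 0 → T.Anc w u ∨ T.Anc w v ∨ T.Anc w u' ∨ T.Anc w v') :
    ((B.erase T.root).filter (fun w => τ w ≠ 0)).card ≤ 4 * r := by
  have hsub : (B.erase T.root).filter (fun w => τ w ≠ 0) ⊆
      ((B.erase T.root).filter (fun w => T.Anc w u) ∪
        (B.erase T.root).filter (fun w => T.Anc w v)) ∪
      ((B.erase T.root).filter (fun w => T.Anc w u') ∪
        (B.erase T.root).filter (fun w => T.Anc w v')) := by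
    intro w hw
    simp only [Finset.mem_filter, Finset.mem_union] at hw ⊢
    have := hτ w hw.2
    tauto
  have h1 := Finset.card_le_card hsub
  have h2 := Finset.card_union_le ((B.erase T.root).filter (fun w => T.Anc w u) ∪
        (B.erase T.root).filter (fun w => T.Anc w v))
      ((B.erase T.root).filter (fun w => T.Anc w u') ∪
        (B.erase T.root).filter (fun w => T.Anc w v'))
  have h3 := Finset.card_union_le ((B.erase T.root).filter (fun w => T.Anc w u))
    ((B.erase T.root).filter (fun w => T.Anc w v))
  have h4 := Finset.card_union_le ((B.erase T.root).filter (fun w => T.Anc w u'))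
    ((B.erase T.root).filter (fun w => T.Anc w v'))
  have h5 := T.card_anc_le hu
  have h6 := T.card_anc_le hv
  have h7 := T.card_anc_le hu'
  have h8 := T.card_anc_le hv'
  omega

open scoped Classical in
/-- A non-tree edge joining two consecutive levels closes an even cycle. -/
theorem exists_isShortRelation_of_depth_ne (T : BFSTree s t E B r) {a : α} (ha : a ∈ E)
    (hs : s a ∈ B) (ht : t a ∈ B) (haT : ∀ w ∈ B.erase T.root, T.edge w ≠ a)
    (hd : T.depth (s a) ≠ T.depth (t a)) : ∃ x, IsShortRelation s t E (4 * r + 2) x := by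
  have hpow : (-1 : ℤ) ^ T.depth (t a) = -(-1) ^ T.depth (s a) := by
    have := T.depth_ends a ha hs ht
    have h' : T.depth (t a) = T.depth (s a) + 1 ∨ T.depth (s a) = T.depth (t a) + 1 := by omega
    rcases h' with h' | h' <;> rw [h'] <;> ring
  refine T.exists_isShortRelation (fun b => if b = a then 1 else 0)
    (fun w => -(-1) ^ T.depth (s a) * (T.stem (s a) w - T.stem (t a) w))
    (fun b => ?_) (fun b hb => ?_) (fun b hb => ?_) ⟨a, by simp⟩ (fun w _ => ?_) (fun z => ?_) ?_
  · split_ifs <;> simp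
  · obtain rfl : b = a := by simpa using hb
    exact ha
  · obtain rfl : b = a := by simpa using hb
    exact haT
  · rw [abs_mul, abs_neg, abs_pow, abs_neg, abs_one, one_pow, one_mul]
    rcases T.stem_cases (s a) w with ⟨-, h⟩ | ⟨-, h⟩ <;>
      rcases T.stem_cases (t a) w with ⟨-, h'⟩ | ⟨-, h'⟩ <;> rw [h, h'] <;> simp
  · have h1 := T.stem_boundary z _ (s a) hs rfl
    have h2 := T.stem_boundary z _ (t a) ht rfl
    have h3 : ((-1 : ℤ) ^ T.depth (s a)) * (-1) ^ T.depth (s a) = 1 := by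
      rw [← mul_pow]; simp
    simp only [mul_assoc, sub_mul, ← Finset.mul_sum, Finset.sum_sub_distrib]
    rw [h1, h2, hpow]
    simp only [ite_mul, one_mul, zero_mul]
    rw [Finset.sum_ite_eq', if_pos ha]
    unfold incidence
    linear_combination -((if s a = z then 1 else 0) + (if t a = z then 1 else 0) : ℤ) * h3
  · have h1 : (E.filter (fun b => (if b = a then (1 : ℤ) else 0) ≠ 0)).card ≤ 1 := by
      refine Finset.card_le_one.2 fun b hb c hc => ?_
      simp only [Finset.mem_filter, ne_eq, ite_eq_right_iff, one_ne_zero, imp_false,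
        not_not] at hb hc
      rw [hb.2, hc.2]
    have h2 := T.card_stem_le hs ht hs ht
      (fun w => -(-1) ^ T.depth (s a) * (T.stem (s a) w - T.stem (t a) w)) (fun w hw => by
        rcases T.stem_cases (s a) w with ⟨g, h⟩ | ⟨g, h⟩
        · exact Or.inl g
        · rcases T.stem_cases (t a) w with ⟨g', h'⟩ | ⟨g', h'⟩
          · exact Or.inr (Or.inl g')
          · simp [h, h'] at hw)
    omega

/-- The vertex set of the cycle formed by the edge `a` and the tree, when `a` joins two vertices
of the same level. -/
def cycle (T : BFSTree s t E B r) (a : α) : Set V :=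
  {z | (T.Anc z (s a) ∨ T.Anc z (t a)) ∧ ∀ w, T.Anc w (s a) → T.Anc w (t a) → T.Anc w z}

open scoped Classical in
/-- Two odd cycles that share a vertex carry a short relation. -/
theorem exists_isShortRelation_of_mem_cycle (T : BFSTree s t E B r) {a b : α} (hab : a ≠ b)
    (ha : a ∈ E) (hb : b ∈ E) (has : s a ∈ B) (hat : t a ∈ B) (hbs : s b ∈ B) (hbt : t b ∈ B)
    (haT : ∀ w ∈ B.erase T.root, T.edge w ≠ a) (hbT : ∀ w ∈ B.erase T.root, T.edge w ≠ b)
    (had : T.depth (s a) = T.depth (t a)) (hbd : T.depth (s b) = T.depth (t b))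
    {z : V} (hza : z ∈ T.cycle a) (hzb : z ∈ T.cycle b) :
    ∃ x, IsShortRelation s t E (4 * r + 2) x := by
  have hcne : ∀ e, ((if e = a then (-1 : ℤ) ^ T.depth (s a) else 0) -
      (if e = b then (-1) ^ T.depth (s b) else 0)) ≠ 0 → e = a ∨ e = b := by
    intro e he
    by_contra! hcon
    simp [hcon.1, hcon.2] at he
  refine T.exists_isShortRelation (fun e => (if e = a then (-1) ^ T.depth (s a) else 0) -
      (if e = b then (-1) ^ T.depth (s b) else 0))
    (fun w => (T.stem (s b) w + T.stem (t b) w) - (T.stem (s a) w + T.stem (t a) w))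
    (fun e => ?_) (fun e he => ?_) (fun e he => ?_) ⟨a, by simp [hab]⟩ (fun w _ => ?_)
    (fun y => ?_) ?_
  · by_cases h : e = a
    · subst h
      simp [hab]
    · by_cases h' : e = b <;> simp [h, h', hab.symm]
  · rcases hcne e he with rfl | rfl
    · exact ha
    · exact hb
  · rcases hcne e he with rfl | rfl
    · exact haT
    · exact hbT
  · have h1 : T.Anc w (s a) → T.Anc w (t a) → T.Anc w (s b) ∨ T.Anc w (t b) := fun h h' =>
      hzb.1.imp (fun g => (hza.2 w h h').trans g) (fun g => (hza.2 w h h').trans g)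
    have h2 : T.Anc w (s b) → T.Anc w (t b) → T.Anc w (s a) ∨ T.Anc w (t a) := fun h h' =>
      hza.1.imp (fun g => (hzb.2 w h h').trans g) (fun g => (hzb.2 w h h').trans g)
    rcases T.stem_cases (s a) w with ⟨g1, e1⟩ | ⟨g1, e1⟩ <;>
      rcases T.stem_cases (t a) w with ⟨g2, e2⟩ | ⟨g2, e2⟩ <;>
      rcases T.stem_cases (s b) w with ⟨g3, e3⟩ | ⟨g3, e3⟩ <;>
      rcases T.stem_cases (t b) w with ⟨g4, e4⟩ | ⟨g4, e4⟩ <;>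
      first
        | exact ((h1 g1 g2).elim g3 g4).elim
        | exact ((h2 g3 g4).elim g1 g2).elim
        | (rw [e1, e2, e3, e4]; simp)
  · have h1 := T.stem_boundary y _ (s a) has rfl
    have h2 := T.stem_boundary y _ (t a) hat rfl
    have h3 := T.stem_boundary y _ (s b) hbs rfl
    have h4 := T.stem_boundary y _ (t b) hbt rfl
    simp only [sub_mul _ _ (_ + _), sub_mul _ _ (incidence _ _ _ _), add_mul _ _ (_ + _),
      Finset.sum_sub_distrib]
    rw [Finset.sum_add_distrib, Finset.sum_add_distrib, h1, h2, h3, h4]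
    simp only [ite_mul, zero_mul]
    rw [Finset.sum_ite_eq', Finset.sum_ite_eq', if_pos ha, if_pos hb, had, hbd]
    unfold incidence
    ring
  · have h1 : (E.filter (fun e => ((if e = a then (-1 : ℤ) ^ T.depth (s a) else 0) -
        (if e = b then (-1) ^ T.depth (s b) else 0)) ≠ 0)).card ≤ 2 := by
      refine (Finset.card_le_card (t := {a, b}) fun e he => ?_).trans Finset.card_le_two
      rw [Finset.mem_filter] at he
      simpa using hcne e he.2
    have h2 := T.card_stem_le has hat hbs hbt
      (fun w => (T.stem (s b) w + T.stem (t b) w) - (T.stem (s a) w + T.stem (t a) w))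
      (fun w hw => by
        by_contra! hcon
        simp [stem, hcon] at hw)
    omega

open scoped Classical in
theorem two_le_sum_cycle (T : BFSTree s t E B r) {a : α} (has : s a ∈ B)
    (hat : t a ∈ B) (had : T.depth (s a) = T.depth (t a)) (W : V → ℕ)
    (hloop : ∀ e, s e = t e → e = a → 2 ≤ W (s e))
    (hW : ∀ e ∈ insert a E, s e ≠ t e → 1 ≤ W (s e) ∨ 1 ≤ W (t e)) :
    2 ≤ ∑ z ∈ B.filter (fun z => z ∈ T.cycle a), W z := by
  have hsC : s a ∈ B.filter (fun z => z ∈ T.cycle a) :=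
    Finset.mem_filter.2 ⟨has, Or.inl (T.anc_refl _), fun w h _ => h⟩
  have htC : t a ∈ B.filter (fun z => z ∈ T.cycle a) :=
    Finset.mem_filter.2 ⟨hat, Or.inr (T.anc_refl _), fun w _ h => h⟩
  by_cases hst : s a = t a
  · exact (hloop a hst rfl).trans (Finset.single_le_sum (f := W) (fun _ _ => Nat.zero_le _) hsC)
  have hpair : ∀ u v, u ≠ v → u ∈ B.filter (fun z => z ∈ T.cycle a) →
      v ∈ B.filter (fun z => z ∈ T.cycle a) → 1 ≤ W u → 1 ≤ W v →
      2 ≤ ∑ z ∈ B.filter (fun z => z ∈ T.cycle a), W z := by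
    intro u v huv hu hv h1 h2
    have : ∑ z ∈ {u, v}, W z ≤ ∑ z ∈ B.filter (fun z => z ∈ T.cycle a), W z :=
      Finset.sum_le_sum_of_subset (by
        intro z hz
        rw [Finset.mem_insert, Finset.mem_singleton] at hz
        rcases hz with rfl | rfl <;> assumption)
    rw [Finset.sum_pair huv] at this
    omega
  have hne : ∀ u ∈ B, ∀ v ∈ B, u ≠ v → T.depth u = T.depth v → u ≠ T.root := by
    rintro u hu v hv huv hd rfl
    rw [T.depth_root] at hd
    exact huv (T.eq_root_of_depth hv hd.symm).symm
  have hpar : ∀ v ∈ B, v ≠ T.root → W v = 0 → 1 ≤ W (T.par v) := by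
    intro v hv hv' h0
    have hd := T.depth_par v hv hv'
    have hvp : T.par v ≠ v := fun h => by rw [h] at hd; omega
    rcases T.edge_ends v hv hv' with ⟨h1, h2⟩ | ⟨h1, h2⟩
    · have := hW _ (Finset.mem_insert_of_mem (T.edge_mem v hv hv')) (by rw [h1, h2]; exact hvp.symm)
      rw [h1, h2] at this
      omega
    · have := hW _ (Finset.mem_insert_of_mem (T.edge_mem v hv hv')) (by rw [h1, h2]; exact hvp)
      rw [h1, h2] at this
      omega
  have hs' := hne _ has _ hat hst had
  have ht' := hne _ hat _ has (Ne.symm hst) had.symm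
  have hds := T.depth_par _ has hs'
  have hdt := T.depth_par _ hat ht'
  have hends := hW a (Finset.mem_insert_self _ _) hst
  by_cases hWs : W (s a) = 0
  · refine hpair (t a) (T.par (s a)) (fun h => ?_) htC ?_ (by omega) (hpar _ has hs' hWs)
    · rw [← h] at hds
      omega
    · refine Finset.mem_filter.2 ⟨T.par_mem _ has, Or.inl ⟨1, rfl⟩, fun w h1 h2 => ?_⟩
      rcases (T.anc_iff w (s a)).1 h1 with rfl | h
      · exact absurd (h2.eq_of_depth_eq hat had) hst
      · exact h
  · by_cases hWt : W (t a) = 0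
    · refine hpair (s a) (T.par (t a)) (fun h => ?_) hsC ?_ (by omega) (hpar _ hat ht' hWt)
      · rw [← h] at hdt
        omega
      · refine Finset.mem_filter.2 ⟨T.par_mem _ hat, Or.inr ⟨1, rfl⟩, fun w h1 h2 => ?_⟩
        rcases (T.anc_iff w (t a)).1 h2 with rfl | h
        · exact absurd (h1.eq_of_depth_eq has had.symm).symm hst
        · exact h
    · exact hpair _ _ hst hsC htC (by omega) (by omega)

open scoped Classical in
/-- Without short relations, a graph spanned by a shallow tree has few edges. -/
theorem two_mul_card_le (T : BFSTree s t E B r) (W : V → ℕ)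
    (hloop : ∀ e ∈ E, s e = t e → 2 ≤ W (s e))
    (hW : ∀ e ∈ E, s e ≠ t e → 1 ≤ W (s e) ∨ 1 ≤ W (t e))
    (hE : ¬ ∃ x, IsShortRelation s t E (4 * r + 2) x) :
    2 * (E.filter (fun a => s a ∈ B ∧ t a ∈ B)).card ≤ ∑ v ∈ B, (2 + W v) := by
  set D := (E.filter (fun a => s a ∈ B ∧ t a ∈ B)).filter
    (fun a => ∀ w ∈ B.erase T.root, T.edge w ≠ a) with hD
  have hDmem : ∀ a ∈ D, a ∈ E ∧ s a ∈ B ∧ t a ∈ B ∧ (∀ w ∈ B.erase T.root, T.edge w ≠ a) ∧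
      T.depth (s a) = T.depth (t a) := by
    intro a ha
    simp only [hD, Finset.mem_filter] at ha
    obtain ⟨⟨h1, h2, h3⟩, h4⟩ := ha
    refine ⟨h1, h2, h3, h4, ?_⟩
    by_contra hd
    exact hE (T.exists_isShortRelation_of_depth_ne h1 h2 h3 h4 hd)
  have h1 : 2 * D.card ≤ ∑ v ∈ B, W v := by
    calc 2 * D.card = ∑ a ∈ D, 2 := by rw [Finset.sum_const, smul_eq_mul, mul_comm]
      _ ≤ ∑ a ∈ D, ∑ z ∈ B.filter (fun z => z ∈ T.cycle a), W z := by
          refine Finset.sum_le_sum fun a ha => ?_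
          obtain ⟨g1, g2, g3, g4, g5⟩ := hDmem a ha
          refine T.two_le_sum_cycle g2 g3 g5 W (fun e he hea => hloop e (hea ▸ g1) he) ?_
          rw [Finset.insert_eq_of_mem g1]
          exact hW
      _ = ∑ z ∈ D.biUnion (fun a => B.filter (fun z => z ∈ T.cycle a)), W z := by
          refine (Finset.sum_biUnion fun a ha b hb hab => ?_).symm
          obtain ⟨g1, g2, g3, g4, g5⟩ := hDmem a ha
          obtain ⟨k1, k2, k3, k4, k5⟩ := hDmem b hb
          refine Finset.disjoint_left.2 fun z hza hzb => hE ?_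
          exact T.exists_isShortRelation_of_mem_cycle hab g1 k1 g2 g3 k2 k3 g4 k4 g5 k5
            (Finset.mem_filter.1 hza).2 (Finset.mem_filter.1 hzb).2
      _ ≤ ∑ v ∈ B, W v := Finset.sum_le_sum_of_subset
          (Finset.biUnion_subset.2 fun a _ => Finset.filter_subset _ _)
  have h2 : E.filter (fun a => s a ∈ B ∧ t a ∈ B) ⊆ D ∪ B.image T.edge := by
    intro a ha
    by_cases h : ∀ w ∈ B.erase T.root, T.edge w ≠ a
    · exact Finset.mem_union_left _ (Finset.mem_filter.2 ⟨ha, h⟩)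
    · push Not at h
      obtain ⟨w, hw, rfl⟩ := h
      exact Finset.mem_union_right _ (Finset.mem_image_of_mem _ (Finset.mem_of_mem_erase hw))
  have h3 := Finset.card_le_card h2
  have h4 := Finset.card_union_le D (B.image T.edge)
  have h5 : (B.image T.edge).card ≤ B.card := Finset.card_image_le
  rw [Finset.sum_add_distrib, Finset.sum_const, smul_eq_mul]
  omega

end BFSTree

open scoped Classical in
/-- The ball around `ρ` in the multigraph with edge set `E` and ends `s`, `t`. -/
noncomputable def graphBall {α V : Type*} (s t : α → V) (E : Finset α) (ρ : V) : ℕ → Finset V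
  | 0 => {ρ}
  | j + 1 => graphBall s t E ρ j ∪
      ((E.filter (fun a => s a ∈ graphBall s t E ρ j)).image t ∪
        (E.filter (fun a => t a ∈ graphBall s t E ρ j)).image s)

section Ball

variable {α V : Type*} {s t : α → V} {E : Finset α} {ρ : V}

open scoped Classical in
theorem graphBall_mono : Monotone (graphBall s t E ρ) :=
  monotone_nat_of_le_succ fun j => by
    rw [graphBall]
    exact Finset.subset_union_left

theorem mem_graphBall_root (j : ℕ) : ρ ∈ graphBall s t E ρ j :=
  graphBall_mono (Nat.zero_le j) (by rw [graphBall]; exact Finset.mem_singleton_self _)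

open scoped Classical in
theorem target_mem_graphBall_succ {j : ℕ} {a : α} (ha : a ∈ E) (h : s a ∈ graphBall s t E ρ j) :
    t a ∈ graphBall s t E ρ (j + 1) := by
  rw [graphBall]
  exact Finset.mem_union_right _ (Finset.mem_union_left _
    (Finset.mem_image_of_mem _ (Finset.mem_filter.2 ⟨ha, h⟩)))

open scoped Classical in
theorem source_mem_graphBall_succ {j : ℕ} {a : α} (ha : a ∈ E) (h : t a ∈ graphBall s t E ρ j) :
    s a ∈ graphBall s t E ρ (j + 1) := by
  rw [graphBall]
  exact Finset.mem_union_right _ (Finset.mem_union_right _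
    (Finset.mem_image_of_mem _ (Finset.mem_filter.2 ⟨ha, h⟩)))

open scoped Classical in
theorem exists_of_mem_graphBall_succ {j : ℕ} {v : V} (h : v ∈ graphBall s t E ρ (j + 1))
    (h' : v ∉ graphBall s t E ρ j) :
    ∃ a ∈ E, ∃ w ∈ graphBall s t E ρ j, (s a = v ∧ t a = w) ∨ (s a = w ∧ t a = v) := by
  rw [graphBall, Finset.mem_union, Finset.mem_union, Finset.mem_image, Finset.mem_image] at h
  rcases h with h | ⟨a, ha, hv⟩ | ⟨a, ha, hv⟩
  · exact absurd h h'
  · rw [Finset.mem_filter] at ha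
    exact ⟨a, ha.1, _, ha.2, Or.inr ⟨rfl, hv⟩⟩
  · rw [Finset.mem_filter] at ha
    exact ⟨a, ha.1, _, ha.2, Or.inl ⟨hv, rfl⟩⟩

theorem graphBall_subset {U : Finset V} (hρ : ρ ∈ U) (hU : ∀ a ∈ E, s a ∈ U ∧ t a ∈ U) (j : ℕ) :
    graphBall s t E ρ j ⊆ U := by
  induction j with
  | zero =>
    rw [graphBall]
    exact Finset.singleton_subset_iff.2 hρ
  | succ j ih =>
    intro v hv
    by_cases h : v ∈ graphBall s t E ρ j
    · exact ih h
    · obtain ⟨a, ha, w, -, ⟨rfl, -⟩ | ⟨-, rfl⟩⟩ := exists_of_mem_graphBall_succ hv h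
      · exact (hU a ha).1
      · exact (hU a ha).2

/-- A ball of radius `j` is spanned by a breadth-first search tree of height at most `j`. -/
theorem nonempty_bfsTree_graphBall [Nonempty α] (j : ℕ) :
    Nonempty (BFSTree s t E (graphBall s t E ρ j) j) := by
  classical
  set d : V → ℕ := fun v => sInf {i | v ∈ graphBall s t E ρ i} with hd
  have hdle : ∀ {v i}, v ∈ graphBall s t E ρ i → d v ≤ i := fun h => Nat.sInf_le h
  have hdmem : ∀ {v i}, v ∈ graphBall s t E ρ i → v ∈ graphBall s t E ρ (d v) :=
    fun {v i} h => Nat.sInf_mem (s := {i | v ∈ graphBall s t E ρ i}) ⟨i, h⟩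
  have hends : ∀ a ∈ E, s a ∈ graphBall s t E ρ j → t a ∈ graphBall s t E ρ j →
      d (s a) ≤ d (t a) + 1 ∧ d (t a) ≤ d (s a) + 1 := fun a ha hs ht =>
    ⟨hdle (source_mem_graphBall_succ ha (hdmem ht)),
      hdle (target_mem_graphBall_succ ha (hdmem hs))⟩
  have hpar : ∀ v, ∃ p : V × Option α, (v = ρ → p.1 = ρ) ∧
      (v ∈ graphBall s t E ρ j → p.1 ∈ graphBall s t E ρ j) ∧
      (v ∈ graphBall s t E ρ j → v ≠ ρ → d p.1 + 1 = d v ∧ ∃ a ∈ E, p.2 = some a ∧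
        ((s a = v ∧ t a = p.1) ∨ (s a = p.1 ∧ t a = v))) := by
    intro v
    by_cases hv : v ∈ graphBall s t E ρ j
    · by_cases hvρ : v = ρ
      · exact ⟨(v, none), fun h => h, fun h => h, fun _ h => absurd hvρ h⟩
      · have h0 : d v ≠ 0 := by
          intro h0
          have := hdmem hv
          rw [h0, graphBall, Finset.mem_singleton] at this
          exact hvρ this
        obtain ⟨k, hk⟩ := Nat.exists_eq_succ_of_ne_zero h0
        have h1 : v ∈ graphBall s t E ρ (k + 1) := by
          have := hdmem hv
          rwa [hk] at this
        have h2 : v ∉ graphBall s t E ρ k := fun h => by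
          have := hdle h
          omega
        have hkj : k ≤ j := by
          have := hdle hv
          omega
        obtain ⟨a, ha, w, hw, hor⟩ := exists_of_mem_graphBall_succ h1 h2
        have hwj : w ∈ graphBall s t E ρ j := graphBall_mono hkj hw
        refine ⟨(w, some a), fun h => absurd h hvρ, fun _ => hwj,
          fun _ _ => ⟨?_, a, ha, rfl, hor⟩⟩
        have hw' := hdle hw
        have : d v ≤ d w + 1 := by
          rcases hor with ⟨g, g'⟩ | ⟨g, g'⟩
          · have := (hends a ha (g ▸ hv) (g' ▸ hwj)).1
            rwa [g, g'] at this
          · have := (hends a ha (g ▸ hwj) (g' ▸ hv)).2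
            rwa [g, g'] at this
        simp only
        omega
    · refine ⟨(v, none), fun h => h, fun h => absurd h hv, fun h => absurd h hv⟩
  choose p hp1 hp2 hp3 using hpar
  obtain ⟨a₀⟩ := ‹Nonempty α›
  refine ⟨⟨ρ, d, fun v => (p v).1, fun v => (p v).2.getD a₀, mem_graphBall_root j, hp1 ρ rfl,
    Nat.le_zero.1 (hdle (mem_graphBall_root 0)), hp2, fun v hv h => (hp3 v hv h).1,
    fun v hv h => ?_, fun v hv h => ?_, fun v hv => hdle hv, hends⟩⟩
  · obtain ⟨-, a, ha, hpa, -⟩ := hp3 v hv h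
    simpa [hpa] using ha
  · obtain ⟨-, a, -, hpa, hor⟩ := hp3 v hv h
    simpa [hpa] using hor

open scoped Classical in
/-- Some ball of bounded radius has a small edge boundary. -/
theorem exists_graphBall_boundary_le (s t : α → V) (E : Finset α) (ρ : V) (n l : ℕ)
    (hn : 0 < n) (hl : E.card < 2 ^ l) :
    ∃ j ≤ n * l, n * (E.filter (fun a => ¬ (s a ∈ graphBall s t E ρ j ↔
      t a ∈ graphBall s t E ρ j))).card ≤
      (E.filter (fun a => s a ∈ graphBall s t E ρ j ∨ t a ∈ graphBall s t E ρ j)).card := by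
  by_contra hex
  set m : ℕ → ℕ := fun j => (E.filter (fun a => s a ∈ graphBall s t E ρ j ∨
    t a ∈ graphBall s t E ρ j)).card with hm
  set c : ℕ → ℕ := fun j => (E.filter (fun a => ¬ (s a ∈ graphBall s t E ρ j ↔
      t a ∈ graphBall s t E ρ j))).card with hc
  have hcon : ∀ j ≤ n * l, m j < n * c j := fun j hj => not_le.1 fun h => hex ⟨j, hj, h⟩
  have hstep : ∀ j, m j + c (j + 1) ≤ m (j + 1) := by
    intro j
    rw [hm, hc]
    simp only
    rw [← Finset.card_union_of_disjoint]
    · refine Finset.card_le_card fun a ha => ?_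
      rw [Finset.mem_union, Finset.mem_filter, Finset.mem_filter] at ha
      rw [Finset.mem_filter]
      rcases ha with ⟨h1, h2⟩ | ⟨h1, h2⟩
      · exact ⟨h1, h2.imp (fun h => graphBall_mono (Nat.le_succ j) h)
          (fun h => graphBall_mono (Nat.le_succ j) h)⟩
      · exact ⟨h1, by tauto⟩
    · refine Finset.disjoint_left.2 fun a ha ha' => ?_
      rw [Finset.mem_filter] at ha ha'
      refine ha'.2 ?_
      rcases ha.2 with h | h
      · exact ⟨fun _ => target_mem_graphBall_succ ha.1 h, fun _ => graphBall_mono (Nat.le_succ j) h⟩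
      · exact ⟨fun _ => graphBall_mono (Nat.le_succ j) h, fun _ => source_mem_graphBall_succ ha.1 h⟩
  have hcm : ∀ j, c j ≤ m j := fun j => Finset.card_le_card fun a ha => by
    rw [Finset.mem_filter] at ha ⊢
    exact ⟨ha.1, by tauto⟩
  have hgrow : ∀ j ≤ n * l, ((1 : ℝ) + 1 / n) ^ j ≤ m j := by
    intro j
    have hn' : (0 : ℝ) < n := by exact_mod_cast hn
    induction j with
    | zero =>
      intro _
      have h0 : m 0 < n * c 0 := hcon 0 (Nat.zero_le _)
      have h1 : 1 ≤ c 0 := by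
        by_contra h
        have : c 0 = 0 := by omega
        rw [this] at h0
        omega
      have h2 := hcm 0
      rw [pow_zero]
      exact_mod_cast h1.trans h2
    | succ j ih =>
      intro hj
      have h1 : m (j + 1) < n * c (j + 1) := hcon (j + 1) hj
      have h2 := hstep j
      have h3 : m j + n * m j ≤ n * m (j + 1) := by nlinarith
      have h3' : (m j : ℝ) + n * m j ≤ n * m (j + 1) := by exact_mod_cast h3
      have h4 := ih (by omega)
      have h5 : (1 + 1 / (n : ℝ)) * m j ≤ m (j + 1) := by
        rw [one_add_div hn'.ne', div_mul_eq_mul_div, div_le_iff₀ hn']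
        linarith
      calc (1 + 1 / (n : ℝ)) ^ (j + 1) = (1 + 1 / (n : ℝ)) * (1 + 1 / (n : ℝ)) ^ j := by ring
        _ ≤ (1 + 1 / (n : ℝ)) * m j := by gcongr
        _ ≤ _ := h5
  have h1 := hgrow (n * l) le_rfl
  have h2 : (2 : ℝ) ≤ (1 + 1 / (n : ℝ)) ^ n := by
    have hn' : (0 : ℝ) < n := by exact_mod_cast hn
    have h := one_add_mul_le_pow (a := 1 / (n : ℝ))
      (le_trans (by norm_num) (by positivity : (0 : ℝ) ≤ 1 / n)) n
    rw [mul_one_div_cancel hn'.ne'] at h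
    linarith
  have h3 : (2 : ℝ) ^ l ≤ m (n * l) := by
    refine le_trans ?_ h1
    rw [pow_mul]
    gcongr
  have h4 : m (n * l) ≤ E.card := Finset.card_filter_le _ _
  have h5 : 2 ^ l ≤ m (n * l) := by exact_mod_cast h3
  omega

open scoped Classical in
/-- Without short relations, the number of edges is bounded by the weight of the vertices, up to
a small proportion of the edges. -/
theorem two_mul_card_le_of_no_short_relation [Nonempty α] (s t : α → V) (W : V → ℕ) (n l : ℕ) (hn : 0 < n) :
    ∀ (k : ℕ) (U : Finset V) (E : Finset α), U.card = k →
    (∀ a ∈ E, s a ∈ U ∧ t a ∈ U) → E.card < 2 ^ l →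
    (∀ e ∈ E, s e = t e → 2 ≤ W (s e)) →
    (∀ e ∈ E, s e ≠ t e → 1 ≤ W (s e) ∨ 1 ≤ W (t e)) →
    (¬ ∃ x, IsShortRelation s t E (4 * (n * l) + 2) x) →
    2 * n * E.card ≤ n * ∑ v ∈ U, (2 + W v) + 2 * E.card := by
  intro k
  induction k using Nat.strong_induction_on with
  | _ k ih =>
  intro U E hk hU hl hloop hW hE
  rcases U.eq_empty_or_nonempty with rfl | ⟨ρ, hρ⟩
  · have : E = ∅ := Finset.eq_empty_of_forall_notMem fun a ha =>
      absurd (hU a ha).1 (Finset.notMem_empty _)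
    simp [this]
  obtain ⟨j, hj, hcut⟩ := exists_graphBall_boundary_le s t E ρ n l hn hl
  set B := graphBall s t E ρ j with hB
  have hBU : B ⊆ U := graphBall_subset hρ hU j
  obtain ⟨T⟩ := nonempty_bfsTree_graphBall (s := s) (t := t) (E := E) (ρ := ρ) j
  have hin := T.two_mul_card_le W hloop hW (by
    rintro ⟨x, h1, h2, h3, h4, h5⟩
    exact hE ⟨x, h1, h2, h3, h4, h5.trans (by omega)⟩)
  rw [← hB] at hin
  set E' := E.filter (fun a => ¬ (s a ∈ B ∨ t a ∈ B)) with hE'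
  have hE'E : E' ⊆ E := Finset.filter_subset _ _
  have hlt : (U \ B).card < k := by
    rw [← hk]
    refine Finset.card_lt_card (Finset.ssubset_iff_of_subset Finset.sdiff_subset |>.2
      ⟨ρ, hρ, fun h => (Finset.mem_sdiff.1 h).2 (mem_graphBall_root j)⟩)
  have hrec := ih _ hlt (U \ B) E' rfl (fun a ha => by
      rw [hE', Finset.mem_filter] at ha
      rw [Finset.mem_sdiff, Finset.mem_sdiff]
      have := hU a ha.1
      tauto)
    ((Finset.card_le_card hE'E).trans_lt hl) (fun e he => hloop e (hE'E he))
    (fun e he => hW e (hE'E he)) (fun ⟨x, hx⟩ => hE ⟨x, hx.mono hE'E⟩)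
  have hsum : ∑ v ∈ U, (2 + W v) = ∑ v ∈ U \ B, (2 + W v) + ∑ v ∈ B, (2 + W v) :=
    (Finset.sum_sdiff hBU).symm
  have hcard1 : (E.filter (fun a => s a ∈ B ∨ t a ∈ B)).card + E'.card = E.card :=
    Finset.card_filter_add_card_filter_not _
  have hcard2 : (E.filter (fun a => s a ∈ B ∨ t a ∈ B)).card =
      (E.filter (fun a => s a ∈ B ∧ t a ∈ B)).card +
      (E.filter (fun a => ¬ (s a ∈ B ↔ t a ∈ B))).card := by
    rw [← Finset.card_union_of_disjoint]
    · congr 1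
      ext a
      simp only [Finset.mem_union, Finset.mem_filter]
      tauto
    · refine Finset.disjoint_left.2 fun a ha ha' => ?_
      rw [Finset.mem_filter] at ha ha'
      tauto
  rw [hsum, ← hcard1]
  nlinarith

end Ball

open scoped Classical in
/-- Removing short relations one after the other: either none is left after `k` steps, or there
are `2 ^ k` sets of removed edges with equal degrees. -/
theorem exists_no_short_relation_or_family {α V : Type*} [DecidableEq α] (s t : α → V) (A : Finset α) (m k : ℕ) :
    (∃ E ⊆ A, (A \ E).card ≤ k * m ∧ ¬ ∃ x, IsShortRelation s t E m x) ∨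
    (∃ E ⊆ A, (A \ E).card ≤ k * m ∧ ∃ F : Finset (Finset α), F.card = 2 ^ k ∧
      (∀ D ∈ F, D ⊆ A \ E) ∧ ∀ D ∈ F, ∀ D' ∈ F, ∀ v,
        ∑ a ∈ D, incidence s t v a = ∑ a ∈ D', incidence s t v a) := by
  induction k with
  | zero =>
    refine Or.inr ⟨A, subset_rfl, by simp, {∅}, by simp, by simp, ?_⟩
    intro D hD D' hD' v
    rw [Finset.mem_singleton.1 hD, Finset.mem_singleton.1 hD']
  | succ k ih =>
    rcases ih with ⟨E, hEA, hcard, hE⟩ | ⟨E, hEA, hcard, F, hF, hFA, hFeq⟩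
    · exact Or.inl ⟨E, hEA, hcard.trans (by gcongr; omega), hE⟩
    by_cases hE : ∃ x, IsShortRelation s t E m x
    · obtain ⟨x, hx1, hx2, ⟨a₀, ha₀⟩, hx4, hx5⟩ := hE
      right
      have hval : ∀ a, x a = 0 ∨ x a = 1 ∨ x a = -1 := fun a => by
        have := abs_le.1 (hx1 a)
        omega
      set B := E.filter (fun a => x a = 1) with hB
      set C := E.filter (fun a => x a = -1) with hC
      have hBE : B ⊆ E := Finset.filter_subset _ _
      have hCE : C ⊆ E := Finset.filter_subset _ _
      have hBC : B ≠ C := by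
        intro h
        have ha := hx2 a₀ ha₀
        rcases hval a₀ with h0 | h1 | h1
        · exact ha₀ h0
        · have h2 : a₀ ∈ C := h ▸ Finset.mem_filter.2 ⟨ha, h1⟩
          have := (Finset.mem_filter.1 h2).2
          omega
        · have h2 : a₀ ∈ B := h ▸ Finset.mem_filter.2 ⟨ha, h1⟩
          have := (Finset.mem_filter.1 h2).2
          omega
      have hbal : ∀ v, ∑ a ∈ B, incidence s t v a = ∑ a ∈ C, incidence s t v a := by
        intro v
        rw [← sub_eq_zero, ← hx4 v, hB, hC, Finset.sum_filter, Finset.sum_filter,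
          ← Finset.sum_sub_distrib]
        refine Finset.sum_congr rfl fun a _ => ?_
        rcases hval a with h | h | h <;> simp [h]
      have hrec : ∀ D ∈ F, ∀ X, X ⊆ E → (D ∪ X) \ E = D ∧ (D ∪ X) ∩ E = X := by
        intro D hD X hX
        have := hFA D hD
        constructor
        · ext a
          have h1 := @this a
          have h2 := @hX a
          simp only [Finset.mem_sdiff, Finset.mem_union] at h1 ⊢
          tauto
        · ext a
          have h1 := @this a
          have h2 := @hX a
          simp only [Finset.mem_sdiff, Finset.mem_inter, Finset.mem_union] at h1 ⊢
          tauto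
      have hinj : ∀ X, X ⊆ E → (F.image (fun D => D ∪ X)).card = F.card := fun X hX =>
        Finset.card_image_of_injOn fun D hD D' hD' h => by
          have h : D ∪ X = D' ∪ X := h
          rw [← (hrec D hD X hX).1, h, (hrec D' hD' X hX).1]
      refine ⟨E.filter (fun a => x a = 0), (Finset.filter_subset _ _).trans hEA, ?_,
        F.image (fun D => D ∪ B) ∪ F.image (fun D => D ∪ C), ?_, ?_, ?_⟩
      · have hsub : A \ E.filter (fun a => x a = 0) ⊆ (A \ E) ∪ E.filter (fun a => x a ≠ 0) := by
          intro a ha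
          simp only [Finset.mem_sdiff, Finset.mem_union, Finset.mem_filter] at ha ⊢
          tauto
        have h1 := Finset.card_le_card hsub
        have h2 := Finset.card_union_le (A \ E) (E.filter (fun a => x a ≠ 0))
        rw [add_mul, one_mul]
        omega
      · rw [Finset.card_union_of_disjoint, hinj B hBE, hinj C hCE, hF]
        · ring
        · refine Finset.disjoint_left.2 fun Y hY hY' => hBC ?_
          obtain ⟨D, hD, rfl⟩ := Finset.mem_image.1 hY
          obtain ⟨D', hD', h⟩ := Finset.mem_image.1 hY'
          rw [← (hrec D hD B hBE).2, ← (hrec D' hD' C hCE).2, h]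
      · intro Y hY
        have key : ∀ X, (∀ a ∈ X, a ∈ E ∧ x a ≠ 0) → ∀ D ∈ F,
            D ∪ X ⊆ A \ E.filter (fun a => x a = 0) := by
          intro X hX D hD a ha
          simp only [Finset.mem_union, Finset.mem_sdiff, Finset.mem_filter] at ha ⊢
          rcases ha with ha | ha
          · have := Finset.mem_sdiff.1 (hFA D hD ha)
            tauto
          · have := hX a ha
            exact ⟨hEA this.1, fun h => this.2 h.2⟩
        rcases Finset.mem_union.1 hY with h | h <;> obtain ⟨D, hD, rfl⟩ := Finset.mem_image.1 h
        · refine key B (fun a ha => ?_) D hD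
          have := Finset.mem_filter.1 ha
          exact ⟨this.1, by omega⟩
        · refine key C (fun a ha => ?_) D hD
          have := Finset.mem_filter.1 ha
          exact ⟨this.1, by omega⟩
      · have hdisj : ∀ D ∈ F, ∀ X, X ⊆ E → Disjoint D X := fun D hD X hX =>
          Finset.disjoint_left.2 fun a ha ha' => (Finset.mem_sdiff.1 (hFA D hD ha)).2 (hX ha')
        have key : ∀ Y ∈ F.image (fun D => D ∪ B) ∪ F.image (fun D => D ∪ C), ∃ D ∈ F, ∀ v,
            ∑ a ∈ Y, incidence s t v a =
              ∑ a ∈ D, incidence s t v a + ∑ a ∈ B, incidence s t v a := by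
          intro Y hY
          rcases Finset.mem_union.1 hY with h | h <;> obtain ⟨D, hD, rfl⟩ := Finset.mem_image.1 h
          · exact ⟨D, hD, fun v => Finset.sum_union (hdisj D hD B hBE)⟩
          · exact ⟨D, hD, fun v => by rw [hbal v]; exact Finset.sum_union (hdisj D hD C hCE)⟩
        intro Y hY Y' hY' v
        obtain ⟨D, hD, h⟩ := key Y hY
        obtain ⟨D', hD', h'⟩ := key Y' hY'
        rw [h, h', hFeq D hD D' hD' v]
    · exact Or.inl ⟨E, hEA, hcard.trans (by gcongr; omega), hE⟩

theorem factorization_of_one_or_prime {u p : ℕ} (hu : u = 1 ∨ u.Prime) (hp : p.Prime) :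
    u.factorization p = if u = p then 1 else 0 := by
  rcases hu with rfl | hu
  · rw [if_neg hp.one_lt.ne]
    simp
  · rw [hu.factorization, Finsupp.single_apply]

open scoped Classical in
/-- A number up to `N` has at most two prime factors exceeding the cube root of `N`. -/
theorem exists_large_prime_factors {N a : ℕ} (ha : 1 ≤ a) (haN : a ≤ N) :
    ∃ u v, (u = 1 ∨ u.Prime ∧ N < u ^ 3) ∧ (v = 1 ∨ v.Prime ∧ N < v ^ 3) ∧ u * v ∣ a ∧
      ∀ p, p.Prime → N < p ^ 3 →
        (a.factorization p : ℤ) = (if u = p then 1 else 0) + (if v = p then 1 else 0) := by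
  have key : ∃ u v c, (u = 1 ∨ u.Prime ∧ N < u ^ 3) ∧ (v = 1 ∨ v.Prime ∧ N < v ^ 3) ∧
      a = u * v * c ∧ ∀ p, p.Prime → N < p ^ 3 → ¬ p ∣ c := by
    by_cases h1 : ∃ p, p.Prime ∧ N < p ^ 3 ∧ p ∣ a
    · obtain ⟨p, hp, hpN, b, rfl⟩ := h1
      by_cases h2 : ∃ q, q.Prime ∧ N < q ^ 3 ∧ q ∣ b
      · obtain ⟨q, hq, hqN, c, rfl⟩ := h2
        refine ⟨p, q, c, Or.inr ⟨hp, hpN⟩, Or.inr ⟨hq, hqN⟩, by ring, ?_⟩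
        rintro r hr hrN ⟨d, rfl⟩
        have hd : 1 ≤ d := Nat.pos_of_ne_zero (by rintro rfl; simp at ha)
        have h3 : p * q * r ≤ N := by
          refine le_trans ?_ haN
          calc p * q * r = p * q * r * 1 := (mul_one _).symm
            _ ≤ p * q * r * d := by gcongr
            _ = p * (q * (r * d)) := by ring
        have h4 : (p * q * r) ^ 3 ≤ N ^ 3 := Nat.pow_le_pow_left h3 3
        have h5 : N ^ 3 < (p * q * r) ^ 3 := by
          calc N ^ 3 = N * N * N := by ring
            _ < p ^ 3 * q ^ 3 * r ^ 3 := by gcongr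
            _ = _ := by ring
        omega
      · push Not at h2
        exact ⟨p, 1, b, Or.inr ⟨hp, hpN⟩, Or.inl rfl, by ring, h2⟩
    · push Not at h1
      exact ⟨1, 1, a, Or.inl rfl, Or.inl rfl, by ring, h1⟩
  obtain ⟨u, v, c, hu, hv, rfl, hc⟩ := key
  refine ⟨u, v, hu, hv, Dvd.intro _ rfl, fun p hp hpN => ?_⟩
  have hu0 : u ≠ 0 := by rintro rfl; simp at ha
  have hv0 : v ≠ 0 := by rintro rfl; simp at ha
  have hc0 : c ≠ 0 := by rintro rfl; simp at ha
  rw [Nat.factorization_mul (mul_ne_zero hu0 hv0) hc0, Nat.factorization_mul hu0 hv0,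
    Finsupp.add_apply, Finsupp.add_apply, Nat.factorization_eq_zero_of_not_dvd (hc p hp hpN),
    factorization_of_one_or_prime (hu.imp_right And.left) hp,
    factorization_of_one_or_prime (hv.imp_right And.left) hp]
  push_cast
  ring

open scoped Classical in
/-- Subsets whose products agree at the large primes are separated by the small primes. -/
theorem card_family_le {N : ℕ} {A : Finset ℕ} (hA : ↑A ⊆ Set.Icc 1 N)
    (hprod : DistinctSubsetProds ↑A) (F : Finset (Finset ℕ)) (hFA : ∀ D ∈ F, D ⊆ A)
    (hF : ∀ D ∈ F, ∀ D' ∈ F, ∀ p, p.Prime → N < p ^ 3 →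
      ∑ a ∈ D, a.factorization p = ∑ a ∈ D', a.factorization p) :
    F.card ≤ (N ^ 2 + 1) ^ ((Finset.range (N + 1)).filter
      (fun p => p.Prime ∧ p ^ 3 ≤ N)).card := by
  set S := (Finset.range (N + 1)).filter (fun p => p.Prime ∧ p ^ 3 ≤ N) with hS
  have hmem : ∀ a ∈ A, 1 ≤ a ∧ a ≤ N := fun a ha => hA ha
  have hne : ∀ D ∈ F, ∀ a ∈ D, a ≠ 0 := fun D hD a ha => by
    have := hmem a (hFA D hD ha)
    omega
  have hAcard : A.card ≤ N := by
    have : A ⊆ Finset.Icc 1 N := fun a ha => Finset.mem_Icc.2 (hmem a ha)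
    simpa using Finset.card_le_card this
  have hcard : (S.pi (fun _ => Finset.range (N ^ 2 + 1))).card = (N ^ 2 + 1) ^ S.card := by
    rw [Finset.card_pi, Finset.prod_const, Finset.card_range]
  rw [← hcard]
  refine Finset.card_le_card_of_injOn (fun D p _ => ∑ a ∈ D, a.factorization p) ?_ ?_
  · intro D hD
    refine Finset.mem_coe.2 (Finset.mem_pi.2 fun p _ => Finset.mem_range.2 (Nat.lt_succ_of_le ?_))
    calc ∑ a ∈ D, a.factorization p ≤ ∑ a ∈ D, N := Finset.sum_le_sum fun a ha =>
          (Nat.factorization_lt p (hne D hD a ha)).le.trans (hmem a (hFA D hD ha)).2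
      _ = D.card * N := by rw [Finset.sum_const, smul_eq_mul]
      _ ≤ N * N := by
          gcongr
          exact (Finset.card_le_card (hFA D hD)).trans hAcard
      _ = N ^ 2 := by ring
  · intro D hD D' hD' h
    refine hprod D D' (Finset.coe_subset.2 (hFA D hD)) (Finset.coe_subset.2 (hFA D' hD')) ?_
    refine Nat.eq_of_factorization_eq (Finset.prod_ne_zero_iff.2 (hne D hD))
      (Finset.prod_ne_zero_iff.2 (hne D' hD')) fun p => ?_
    rw [Nat.factorization_prod (hne D hD), Nat.factorization_prod (hne D' hD'),
      Finsupp.finsetSum_apply, Finsupp.finsetSum_apply]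
    by_cases hp : p.Prime
    · by_cases hpN : N < p ^ 3
      · exact hF D hD D' hD' p hp hpN
      · have hpS : p ∈ S := by
          refine Finset.mem_filter.2 ⟨Finset.mem_range.2 ?_, hp, not_lt.1 hpN⟩
          have : p ≤ p ^ 3 := Nat.le_self_pow (by norm_num) p
          omega
        exact congrFun (congrFun h p) hpS
    · simp [Nat.factorization_eq_zero_of_not_prime _ hp]

set_option maxHeartbeats 1000000 in
open scoped Classical in
theorem two_mul_card_le_of_distinctSubsetProds {N n l : ℕ} {A : Finset ℕ} (hn : 4 ≤ n)
    (hl : N < 2 ^ l) (hA : ↑A ⊆ Set.Icc 1 N) (hprod : DistinctSubsetProds ↑A) :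
    2 * n * A.card ≤ 2 * n * ((2 * l * ((Finset.range (N + 1)).filter
        (fun p => p.Prime ∧ p ^ 3 ≤ N)).card + 1) * (4 * (n * l) + 2)) +
      n * (2 * (((Finset.range (N + 1)).filter (fun p => p.Prime)).card + 1) +
        (2 + ((Finset.range (N + 1)).filter (fun p => p.Prime ∧ N < p ^ 3 ∧ p ^ 2 ≤ N)).card +
        ((Finset.range (N + 1)).filter (fun p => p.Prime ∧ N < p ^ 3 ∧ p ^ 2 ≤ N ∧
          ∃ a ∈ A, p ^ 2 ∣ a)).card)) +
      16 * (1 + ((Finset.range (N + 1)).filter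
        (fun p => p.Prime ∧ N < p ^ 3 ∧ p ^ 2 ≤ N)).card) := by
  set q := ((Finset.range (N + 1)).filter (fun p => p.Prime ∧ p ^ 3 ≤ N)).card with hq
  set light := (Finset.range (N + 1)).filter (fun p => p.Prime ∧ N < p ^ 3 ∧ p ^ 2 ≤ N)
    with hlight
  set P := (Finset.range (N + 1)).filter (fun p => p.Prime ∧ N < p ^ 3 ∧ p ^ 2 ≤ N ∧
          ∃ a ∈ A, p ^ 2 ∣ a) with hP
  set heavy := (Finset.range (N + 1)).filter (fun p => p.Prime ∧ N < p ^ 3 ∧ N < p ^ 2)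
    with hheavy
  have hmem : ∀ a ∈ A, 1 ≤ a ∧ a ≤ N := fun a ha => hA ha
  have hAcard : A.card ≤ N := by
    have : A ⊆ Finset.Icc 1 N := fun a ha => Finset.mem_Icc.2 (hmem a ha)
    simpa using Finset.card_le_card this
  have hends : ∀ a, ∃ uv : ℕ × ℕ, a ∈ A → (uv.1 = 1 ∨ uv.1.Prime ∧ N < uv.1 ^ 3) ∧
      (uv.2 = 1 ∨ uv.2.Prime ∧ N < uv.2 ^ 3) ∧ uv.1 * uv.2 ∣ a ∧
      ∀ p, p.Prime → N < p ^ 3 →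
        (a.factorization p : ℤ) = (if uv.1 = p then 1 else 0) + (if uv.2 = p then 1 else 0) := by
    intro a
    by_cases ha : a ∈ A
    · obtain ⟨u, v, h⟩ := exists_large_prime_factors (hmem a ha).1 (hmem a ha).2
      exact ⟨(u, v), fun _ => h⟩
    · exact ⟨(1, 1), fun h => absurd h ha⟩
  choose g hg using hends
  set s : ℕ → ℕ := fun a => (g a).1 with hs
  set t : ℕ → ℕ := fun a => (g a).2 with ht
  have hs1 : ∀ a ∈ A, s a = 1 ∨ (s a).Prime ∧ N < s a ^ 3 := fun a ha => (hg a ha).1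
  have ht1 : ∀ a ∈ A, t a = 1 ∨ (t a).Prime ∧ N < t a ^ 3 := fun a ha => (hg a ha).2.1
  have hdvd : ∀ a ∈ A, s a * t a ∣ a := fun a ha => (hg a ha).2.2.1
  have hfac : ∀ a ∈ A, ∀ p, p.Prime → N < p ^ 3 →
      (a.factorization p : ℤ) = incidence s t p a := fun a ha p hp hpN => by
    rw [(hg a ha).2.2.2 p hp hpN]
    unfold incidence
    congr
  have hst : ∀ a ∈ A, s a * t a ≤ N := fun a ha =>
    (Nat.le_of_dvd (hmem a ha).1 (hdvd a ha)).trans (hmem a ha).2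
  have hpos : ∀ a ∈ A, 1 ≤ s a ∧ 1 ≤ t a := fun a ha =>
    ⟨(hs1 a ha).elim (fun h => h.ge) (fun h => h.1.pos),
      (ht1 a ha).elim (fun h => h.ge) (fun h => h.1.pos)⟩
  -- remove short relations
  obtain ⟨E, hEA, hEcard, hE⟩ : ∃ E ⊆ A,
      (A \ E).card ≤ (2 * l * q + 1) * (4 * (n * l) + 2) ∧
      ¬ ∃ x, IsShortRelation s t E (4 * (n * l) + 2) x := by
    rcases exists_no_short_relation_or_family s t A (4 * (n * l) + 2) (2 * l * q + 1) with h | h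
    · exact h
    exfalso
    obtain ⟨E, hEA, -, F, hF, hFA, hFeq⟩ := h
    have hFA' : ∀ D ∈ F, D ⊆ A := fun D hD => (hFA D hD).trans Finset.sdiff_subset
    have h1 := card_family_le hA hprod F hFA' (by
      intro D hD D' hD' p hp hpN
      have h := hFeq D hD D' hD' p
      rw [← Finset.sum_congr rfl fun a ha => hfac a (hFA' D hD ha) p hp hpN,
        ← Finset.sum_congr rfl fun a ha => hfac a (hFA' D' hD' ha) p hp hpN] at h
      exact_mod_cast h)
    rw [hF, ← hq] at h1
    have h2 : N ^ 2 + 1 ≤ 2 ^ (2 * l) := by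
      have : N ^ 2 < (2 ^ l) ^ 2 := Nat.pow_lt_pow_left hl (by norm_num)
      rw [← pow_mul, mul_comm l 2] at this
      exact this
    have h3 : (N ^ 2 + 1) ^ q ≤ 2 ^ (2 * l * q) := by
      rw [pow_mul]
      exact Nat.pow_le_pow_left h2 q
    have h4 : 2 ^ (2 * l * q) < 2 ^ (2 * l * q + 1) := Nat.pow_lt_pow_right (by norm_num) (by omega)
    omega
  -- the vertex weights
  set W : ℕ → ℕ := fun v => if v = 1 ∨ v ∈ P then 2 else if v ∈ light then 1 else 0 with hW
  have hPl : P ⊆ light := fun p hp => by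
    simp only [hP, hlight, Finset.mem_filter] at hp ⊢
    tauto
  have h1l : 1 ∉ light := fun h => by
    simp only [hlight, Finset.mem_filter] at h
    exact Nat.not_prime_one h.2.1
  have h1h : 1 ∉ heavy := fun h => by
    simp only [hheavy, Finset.mem_filter] at h
    exact Nat.not_prime_one h.2.1
  have hlh : Disjoint light heavy := Finset.disjoint_left.2 fun p hp hp' => by
    simp only [hlight, hheavy, Finset.mem_filter] at hp hp'
    omega
  have hvert : ∀ v, (v = 1 ∨ v.Prime ∧ N < v ^ 3) → v ≤ N → v = 1 ∨ v ∈ light ∨ v ∈ heavy := by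
    intro v hv hvN
    rcases hv with hv | hv
    · exact Or.inl hv
    · right
      simp only [hlight, hheavy, Finset.mem_filter, Finset.mem_range]
      rcases le_or_gt (v ^ 2) N with h | h
      · exact Or.inl ⟨by omega, hv.1, hv.2, h⟩
      · exact Or.inr ⟨by omega, hv.1, hv.2, h⟩
  have hsv : ∀ a ∈ A, s a = 1 ∨ s a ∈ light ∨ s a ∈ heavy := fun a ha =>
    hvert _ (hs1 a ha) ((Nat.le_mul_of_pos_right _ (hpos a ha).2).trans (hst a ha))
  have htv : ∀ a ∈ A, t a = 1 ∨ t a ∈ light ∨ t a ∈ heavy := fun a ha =>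
    hvert _ (ht1 a ha) ((Nat.le_mul_of_pos_left _ (hpos a ha).1).trans (hst a ha))
  have hnotheavy : ∀ a ∈ A, s a ∈ heavy → t a ∈ heavy → False := by
    intro a ha h1 h2
    simp only [hheavy, Finset.mem_filter] at h1 h2
    have h3 : (s a * t a) ^ 2 ≤ N ^ 2 := Nat.pow_le_pow_left (hst a ha) 2
    have h4 : N * N < s a ^ 2 * t a ^ 2 := by
      have := h1.2.2.2
      have := h2.2.2.2
      gcongr
    rw [mul_pow] at h3
    nlinarith
  have hWlight : ∀ v, v = 1 ∨ v ∈ light → 1 ≤ W v := by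
    intro v hv
    simp only [hW]
    split_ifs with h1 h2
    · norm_num
    · norm_num
    · tauto
  have hWedge : ∀ e ∈ E, s e ≠ t e → 1 ≤ W (s e) ∨ 1 ≤ W (t e) := by
    intro e he _
    have h1 := hsv e (hEA he)
    have h2 := htv e (hEA he)
    have h3 := hnotheavy e (hEA he)
    have h4 := hWlight (s e)
    have h5 := hWlight (t e)
    tauto
  have hWloop : ∀ e ∈ E, s e = t e → 2 ≤ W (s e) := by
    intro e he hee
    have : s e = 1 ∨ s e ∈ P := by
      rcases hsv e (hEA he) with h | h | h
      · exact Or.inl h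
      · right
        simp only [hlight, hP, Finset.mem_filter] at h ⊢
        refine ⟨h.1, h.2.1, h.2.2.1, h.2.2.2, e, hEA he, ?_⟩
        have := hdvd e (hEA he)
        rwa [← hee, ← sq] at this
      · exact (hnotheavy e (hEA he) h (hee ▸ h)).elim
    simp only [hW, if_pos this, le_refl]
  -- discard the heavy vertices of degree at most one
  set deg : ℕ → ℕ := fun v => (E.filter (fun a => s a = v ∨ t a = v)).card with hdeg
  set L₁ := heavy.filter (fun v => deg v ≤ 1) with hL₁
  set L₂ := heavy.filter (fun v => ¬ deg v ≤ 1) with hL₂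
  have hL : L₁.card + L₂.card = heavy.card := Finset.card_filter_add_card_filter_not _
  set U := insert 1 light ∪ L₂ with hU
  have hL₁h : L₁ ⊆ heavy := Finset.filter_subset _ _
  have hL₂h : L₂ ⊆ heavy := Finset.filter_subset _ _
  have hUdisj : Disjoint (insert 1 light) L₂ := by
    rw [Finset.disjoint_insert_left]
    exact ⟨fun h => h1h (hL₂h h), hlh.mono_right hL₂h⟩
  have hUcard : U.card = light.card + 1 + L₂.card := by
    rw [hU, Finset.card_union_of_disjoint hUdisj, Finset.card_insert_of_notMem h1l]
  set E' := E.filter (fun a => s a ∈ U ∧ t a ∈ U) with hE'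
  have hE'E : E' ⊆ E := Finset.filter_subset _ _
  have hUor : ∀ v, (v = 1 ∨ v ∈ light ∨ v ∈ heavy) → v ∈ U ∨ v ∈ L₁ := by
    intro v hv
    simp only [hU, hL₁, hL₂, Finset.mem_union, Finset.mem_insert, Finset.mem_filter]
    tauto
  have hEE' : E.card ≤ E'.card + L₁.card := by
    have hsub : E ⊆ E' ∪ L₁.biUnion (fun v => E.filter (fun a => s a = v ∨ t a = v)) := by
      intro a ha
      by_cases h : s a ∈ U ∧ t a ∈ U
      · exact Finset.mem_union_left _ (Finset.mem_filter.2 ⟨ha, h⟩)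
      · refine Finset.mem_union_right _ (Finset.mem_biUnion.2 ?_)
        rcases hUor _ (hsv a (hEA ha)) with h1 | h1
        · rcases hUor _ (htv a (hEA ha)) with h2 | h2
          · exact absurd ⟨h1, h2⟩ h
          · exact ⟨_, h2, Finset.mem_filter.2 ⟨ha, Or.inr rfl⟩⟩
        · exact ⟨_, h1, Finset.mem_filter.2 ⟨ha, Or.inl rfl⟩⟩
    have h1 := Finset.card_le_card hsub
    have h2 := Finset.card_union_le E' (L₁.biUnion (fun v => E.filter (fun a => s a = v ∨ t a = v)))
    have h3 : (L₁.biUnion (fun v => E.filter (fun a => s a = v ∨ t a = v))).card ≤ L₁.card * 1 :=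
      Finset.card_biUnion_le_card_mul _ _ _ fun v hv => (Finset.mem_filter.1 hv).2
    omega
  have hL₂E : 2 * L₂.card ≤ E'.card := by
    have hsub : L₂.biUnion (fun v => E.filter (fun a => s a = v ∨ t a = v)) ⊆ E' := by
      intro a ha
      obtain ⟨v, hv, ha⟩ := Finset.mem_biUnion.1 ha
      obtain ⟨haE, hor⟩ := Finset.mem_filter.1 ha
      have hvU : v ∈ U := Finset.mem_union_right _ hv
      have h4 : ∀ w, (w = 1 ∨ w ∈ light ∨ w ∈ heavy) → w ∉ heavy → w ∈ U := fun w hw hwh =>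
        (hUor w hw).resolve_right fun h => hwh (hL₁h h)
      refine Finset.mem_filter.2 ⟨haE, ?_⟩
      rcases hor with rfl | rfl
      · exact ⟨hvU, h4 _ (htv a (hEA haE)) fun h => hnotheavy a (hEA haE) (hL₂h hv) h⟩
      · exact ⟨h4 _ (hsv a (hEA haE)) fun h => hnotheavy a (hEA haE) h (hL₂h hv), hvU⟩
    refine le_trans ?_ (Finset.card_le_card hsub)
    rw [Finset.card_biUnion]
    · calc 2 * L₂.card = ∑ v ∈ L₂, 2 := by rw [Finset.sum_const, smul_eq_mul, mul_comm]
        _ ≤ _ := Finset.sum_le_sum fun v hv => by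
          have := (Finset.mem_filter.1 hv).2
          simp only [hdeg] at this
          omega
    · intro v hv w hw hvw
      refine Finset.disjoint_left.2 fun a ha ha' => ?_
      obtain ⟨haE, h1⟩ := Finset.mem_filter.1 ha
      obtain ⟨-, h2⟩ := Finset.mem_filter.1 ha'
      have h3 := hnotheavy a (hEA haE)
      have hv' := hL₂h hv
      have hw' := hL₂h hw
      rcases h1 with rfl | rfl <;> rcases h2 with h2 | h2
      · exact hvw h2
      · exact h3 hv' (h2 ▸ hw')
      · exact h3 (h2 ▸ hw') hv'
      · exact hvw h2
  have hWsum : ∑ v ∈ U, W v ≤ 2 + light.card + P.card := by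
    rw [hU, Finset.sum_union hUdisj, Finset.sum_insert h1l]
    have h1 : ∑ v ∈ L₂, W v = 0 := Finset.sum_eq_zero fun v hv => by
      have hvh := hL₂h hv
      have hvl : v ∉ light := fun h => Finset.disjoint_left.1 hlh h hvh
      have hvP : v ∉ P := fun h => hvl (hPl h)
      have hv1 : v ≠ 1 := fun h => h1h (h ▸ hvh)
      simp only [hW, hv1, hvP, hvl, or_self, if_false]
    have h2 : ∑ v ∈ light, W v ≤ ∑ v ∈ light, (1 + if v ∈ P then 1 else 0) :=
      Finset.sum_le_sum fun v hv => by
        have hv1 : v ≠ 1 := fun h => h1l (h ▸ hv)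
        by_cases hvP : v ∈ P <;> simp [hW, hv1, hvP, hv]
    have h3 : ∑ v ∈ light, (if v ∈ P then 1 else 0) = P.card := by
      rw [Finset.sum_ite_mem, Finset.inter_eq_right.2 hPl]
      simp
    have h4 : W 1 = 2 := by simp [hW]
    rw [Finset.sum_add_distrib, h3, Finset.sum_const, smul_eq_mul, mul_one] at h2
    omega
  have hmain := two_mul_card_le_of_no_short_relation s t W n l (by omega) _ U E' rfl
    (fun a ha => (Finset.mem_filter.1 ha).2)
    (((Finset.card_le_card (hE'E.trans hEA)).trans hAcard).trans_lt hl)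
    (fun e he => hWloop e (hE'E he)) (fun e he => hWedge e (hE'E he))
    (fun ⟨x, hx⟩ => hE ⟨x, hx.mono hE'E⟩)
  rw [Finset.sum_add_distrib, Finset.sum_const, smul_eq_mul] at hmain
  have hPcard : P.card ≤ light.card := Finset.card_le_card hPl
  have hprimes : light.card + heavy.card ≤
      ((Finset.range (N + 1)).filter (fun p => p.Prime)).card := by
    rw [← Finset.card_union_of_disjoint hlh]
    refine Finset.card_le_card fun p hp => ?_
    simp only [hlight, hheavy, Finset.mem_union, Finset.mem_filter] at hp ⊢
    tauto
  have hAE : A.card ≤ (A \ E).card + E.card := by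
    rw [Finset.card_sdiff_add_card_eq_card hEA]
  have hE'small : E'.card ≤ 8 * (1 + light.card) := by
    have h1 : U.card * 2 + ∑ v ∈ U, W v ≤ 4 * (1 + light.card) + E'.card := by omega
    have h2 : n * (U.card * 2 + ∑ v ∈ U, W v) ≤ n * (4 * (1 + light.card) + E'.card) := by gcongr
    have h3 : n * E'.card ≤ n * (4 * (1 + light.card)) + 2 * E'.card := by nlinarith
    have h4 : 4 * E'.card ≤ n * E'.card := by gcongr
    have h5 : n * E'.card ≤ n * (8 * (1 + light.card)) := by nlinarith
    exact Nat.le_of_mul_le_mul_left h5 (by omega)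
  set p := ((Finset.range (N + 1)).filter (fun p => p.Prime)).card with hp
  have hfin : U.card * 2 + ∑ v ∈ U, W v + 2 * L₁.card ≤
      2 * (p + 1) + (2 + light.card + P.card) := by omega
  have hfin' : n * (U.card * 2 + ∑ v ∈ U, W v + 2 * L₁.card) ≤
      n * (2 * (p + 1) + (2 + light.card + P.card)) := by gcongr
  have h6 : 2 * n * A.card ≤ 2 * n * ((2 * l * q + 1) * (4 * (n * l) + 2) +
      (E'.card + L₁.card)) := by
    gcongr
    omega
  nlinarith

theorem card_le_of_forall_mem_le {s : Finset ℕ} {y : ℝ} (hy : 0 ≤ y)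
    (hs : ∀ p ∈ s, 0 < p ∧ (p : ℝ) ≤ y) : (s.card : ℝ) ≤ y := by
  have hsub : s ⊆ Finset.Icc 1 ⌊y⌋₊ := fun p hp =>
    Finset.mem_Icc.2 ⟨(hs p hp).1, Nat.le_floor (hs p hp).2⟩
  have hcard := Finset.card_le_card hsub
  rw [Nat.card_Icc, Nat.add_sub_cancel] at hcard
  exact (Nat.cast_le.2 hcard).trans (Nat.floor_le hy)

theorem finite_setOf_natCast_le (y : ℝ) : {p : ℕ | (p : ℝ) ≤ y}.Finite :=
  (Set.finite_Iic ⌊y⌋₊).subset fun _ hp => Nat.le_floor hp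

theorem card_le_ncard {s : Finset ℕ} {t : Set ℕ} {y : ℝ} (hst : ∀ p ∈ s, p ∈ t)
    (ht : ∀ p ∈ t, (p : ℝ) ≤ y) : s.card ≤ t.ncard := by
  rw [← Set.ncard_coe_finset]
  exact Set.ncard_le_ncard hst ((finite_setOf_natCast_le y).subset ht)

/-- The binary length of `N` is at most a constant times any positive power of `N`. -/
theorem exists_log_two_succ_le_rpow {δ : ℝ} (hδ : 0 < δ) :
    ∃ K : ℝ, 0 < K ∧ ∀ N : ℕ, 1 ≤ N → ((Nat.log 2 N + 1 : ℕ) : ℝ) ≤ K * (N : ℝ) ^ δ := by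
  have hlog2 : 0 < Real.log 2 := Real.log_pos one_lt_two
  refine ⟨1 / (δ * Real.log 2) + 1, by positivity, fun N hN => ?_⟩
  have hN' : (1 : ℝ) ≤ N := by exact_mod_cast hN
  have h1 : (1 : ℝ) ≤ (N : ℝ) ^ δ := Real.one_le_rpow hN' hδ.le
  have h2 : (Nat.log 2 N : ℝ) * Real.log 2 ≤ Real.log N := by
    rw [← Real.log_pow]
    refine Real.log_le_log (by positivity) ?_
    exact_mod_cast Nat.pow_log_le_self 2 (by lia)
  have h3 : Real.log N ≤ (N : ℝ) ^ δ / δ := Real.log_le_rpow_div (by positivity) hδ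
  have h4 : (Nat.log 2 N : ℝ) ≤ 1 / (δ * Real.log 2) * (N : ℝ) ^ δ := by
    rw [← le_div_iff₀ hlog2] at h2
    refine h2.trans ?_
    rw [div_le_iff₀ hlog2]
    refine h3.trans (le_of_eq ?_)
    field_simp
  push_cast
  linarith

theorem le_of_two_mul_mul_le {a n L q π l P x : ℝ} (hx : 1 ≤ x) (hxn : x ≤ n)
    (hn : n ≤ 5 * x) (hL : 1 ≤ L) (hq0 : 0 ≤ q) (hq : q ≤ x ^ 4) (hl : l ≤ x ^ 6)
    (h : 2 * n * a ≤ 2 * n * ((2 * L * q + 1) * (4 * (n * L) + 2)) +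
      n * (2 * (π + 1) + (2 + l + P)) + 16 * (1 + l)) :
    a ≤ π + 1 / 2 * l + 1 / 2 * P + (18 * x ^ 5 + 90 * L ^ 2 * x ^ 5) := by
  have hn0 : 0 < n := by linarith
  have hx4 : 1 ≤ x ^ 4 := one_le_pow₀ hx
  have hx5 : 1 ≤ x ^ 5 := one_le_pow₀ hx
  have hx6 : 1 ≤ x ^ 6 := one_le_pow₀ hx
  have h1 : (2 * L * q + 1) * (4 * (n * L) + 2) ≤ 90 * L ^ 2 * x ^ 5 := by
    have e1 : 2 * L * q + 1 ≤ 3 * L * x ^ 4 := by nlinarith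
    have hnL : 1 ≤ n * L := one_le_mul_of_one_le_of_one_le (by linarith) hL
    have hnL' : n * L ≤ 5 * x * L := mul_le_mul_of_nonneg_right hn (by linarith)
    have e2 : 4 * (n * L) + 2 ≤ 30 * (x * L) := by linarith
    calc _ ≤ (3 * L * x ^ 4) * (30 * (x * L)) :=
          mul_le_mul e1 e2 (by linarith) (by positivity)
      _ = _ := by ring
  have h2 : 16 * (1 + l) ≤ 2 * n * (16 * x ^ 5) := by
    have e : x * x ^ 5 ≤ n * x ^ 5 := mul_le_mul_of_nonneg_right hxn (by linarith)
    have e' : x * x ^ 5 = x ^ 6 := by ring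
    linarith
  have h3 := mul_le_mul_of_nonneg_left h1 (by linarith : 0 ≤ 2 * n)
  have h4 := mul_le_mul_of_nonneg_left hx5 hn0.le
  refine le_of_mul_le_mul_left ?_ (by linarith : 0 < 2 * n)
  nlinarith

/-- For `A ⊆ [N]` with distinct subset products,
`|A| ≤ π(N) + (1/2)·π(N^{1/2}) + (1/2)·|P_□| + C·N^{5/12+ε}`, where `P_□` is the set of
primes `p ∈ (N^{1/3}, N^{1/2}]` whose square divides some element of `A`. -/
theorem stmt5 : ∀ ε : ℝ, 0 < ε → ∃ C : ℝ, 0 < C ∧ ∀ N : ℕ, ∀ A : Finset ℕ,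
    ↑A ⊆ Set.Icc 1 N → DistinctSubsetProds ↑A →
    (A.card : ℝ) ≤ primePi N + (1 / 2) * primePi ((N : ℝ) ^ ((1 : ℝ) / 2)) +
      (1 / 2) * ({p : ℕ | p.Prime ∧ (N : ℝ) ^ ((1 : ℝ) / 3) < (p : ℝ) ∧
          (p : ℝ) ≤ (N : ℝ) ^ ((1 : ℝ) / 2) ∧ ∃ a ∈ A, p ^ 2 ∣ a}.ncard : ℝ) +
      C * (N : ℝ) ^ ((5 : ℝ) / 12 + ε) := by
  classical
  intro ε hε
  obtain ⟨K, hK, hlog⟩ := exists_log_two_succ_le_rpow (half_pos hε)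
  refine ⟨18 + 90 * K ^ 2, by positivity, fun N A hA hprod => ?_⟩
  rcases Nat.eq_zero_or_pos N with rfl | hN
  · have hempty : A = ∅ := Finset.eq_empty_of_forall_notMem fun a ha => by
      have := hA ha
      simp only [Set.mem_Icc] at this
      lia
    rw [hempty, Finset.card_empty, Nat.cast_zero]
    positivity
  have hN' : (1 : ℝ) ≤ N := by exact_mod_cast hN
  have hN0 : (0 : ℝ) ≤ N := by linarith
  set x : ℝ := (N : ℝ) ^ ((1 : ℝ) / 12) with hxdef
  have hx : 1 ≤ x := Real.one_le_rpow hN' (by norm_num)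
  have hpow (k : ℕ) : x ^ k = (N : ℝ) ^ ((k : ℝ) / 12) := by
    rw [hxdef, ← Real.rpow_natCast, ← Real.rpow_mul hN0]
    ring_nf
  have hx4 : (N : ℝ) ^ ((1 : ℝ) / 3) = x ^ 4 := by rw [hpow]; norm_num
  have hx6 : (N : ℝ) ^ ((1 : ℝ) / 2) = x ^ 6 := by rw [hpow]; norm_num
  have hx12 : (N : ℝ) = x ^ 12 := by rw [hpow]; norm_num
  have hcube {p : ℕ} : p ^ 3 ≤ N ↔ (p : ℝ) ≤ x ^ 4 := by
    rw [← pow_le_pow_iff_left₀ (a := (p : ℝ)) (by positivity) (by positivity) three_ne_zero,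
      ← pow_mul, ← hx12]
    exact_mod_cast Iff.rfl
  have hsq {p : ℕ} : p ^ 2 ≤ N ↔ (p : ℝ) ≤ x ^ 6 := by
    rw [← pow_le_pow_iff_left₀ (a := (p : ℝ)) (by positivity) (by positivity) two_ne_zero,
      ← pow_mul, ← hx12]
    exact_mod_cast Iff.rfl
  have hmain := two_mul_card_le_of_distinctSubsetProds (n := ⌈x⌉₊ + 3) (l := Nat.log 2 N + 1)
    (by have := Nat.one_le_ceil_iff.2 (by linarith : 0 < x); lia)
    (Nat.lt_pow_succ_log_self one_lt_two N) hA hprod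
  have hq : ((((Finset.range (N + 1)).filter (fun p => p.Prime ∧ p ^ 3 ≤ N)).card : ℕ) : ℝ) ≤
      x ^ 4 := card_le_of_forall_mem_le (by positivity) fun p hp => by
    obtain ⟨-, hp, hpN⟩ := Finset.mem_filter.1 hp
    exact ⟨hp.pos, hcube.1 hpN⟩
  have hlight : ((((Finset.range (N + 1)).filter
      (fun p => p.Prime ∧ N < p ^ 3 ∧ p ^ 2 ≤ N)).card : ℕ) : ℝ) ≤
      x ^ 6 := card_le_of_forall_mem_le (by positivity) fun p hp => by
    obtain ⟨-, hp, -, hpN⟩ := Finset.mem_filter.1 hp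
    exact ⟨hp.pos, hsq.1 hpN⟩
  have hlight' : ((Finset.range (N + 1)).filter
      (fun p => p.Prime ∧ N < p ^ 3 ∧ p ^ 2 ≤ N)).card ≤ primePi (x ^ 6) :=
    card_le_ncard (y := x ^ 6) (fun p hp => by
      obtain ⟨-, hp, -, hpN⟩ := Finset.mem_filter.1 hp
      exact ⟨hp, hsq.1 hpN⟩) fun p hp => hp.2
  have hpi : ((Finset.range (N + 1)).filter (fun p => p.Prime)).card ≤ primePi N :=
    card_le_ncard (y := N) (fun p hp => by
      obtain ⟨hpN, hp⟩ := Finset.mem_filter.1 hp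
      exact ⟨hp, by exact_mod_cast Finset.mem_range_succ_iff.1 hpN⟩) fun p hp => hp.2
  have hP : ((Finset.range (N + 1)).filter (fun p => p.Prime ∧ N < p ^ 3 ∧ p ^ 2 ≤ N ∧
      ∃ a ∈ A, p ^ 2 ∣ a)).card ≤ {p : ℕ | p.Prime ∧ x ^ 4 < (p : ℝ) ∧
          (p : ℝ) ≤ x ^ 6 ∧ ∃ a ∈ A, p ^ 2 ∣ a}.ncard :=
    card_le_ncard (y := x ^ 6) (fun p hp => by
      obtain ⟨-, hp, hpN, hpN', hpA⟩ := Finset.mem_filter.1 hp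
      exact ⟨hp, lt_of_not_ge fun h => hpN.not_ge (hcube.2 h), hsq.1 hpN', hpA⟩)
      fun p hp => hp.2.2.1
  rw [hx4, hx6]
  have hbound := le_of_two_mul_mul_le (x := x) (n := (⌈x⌉₊ + 3 : ℕ))
    (L := (Nat.log 2 N + 1 : ℕ)) hx
    (by push_cast; linarith [Nat.le_ceil x])
    (by push_cast; linarith [Nat.ceil_lt_add_one (by linarith : 0 ≤ x)])
    (by exact_mod_cast Nat.le_add_left 1 _) (Nat.cast_nonneg _) hq hlight
    (by convert (Nat.cast_le (α := ℝ)).2 hmain <;> push_cast <;> rfl)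
  have hL2 : ((Nat.log 2 N + 1 : ℕ) : ℝ) ^ 2 ≤ K ^ 2 * (N : ℝ) ^ ε := by
    calc _ ≤ (K * (N : ℝ) ^ (ε / 2)) ^ 2 := pow_le_pow_left₀ (Nat.cast_nonneg _) (hlog N hN) 2
      _ = _ := by
        rw [mul_pow, ← Real.rpow_mul_natCast hN0]
        norm_num
  have hsplit : (N : ℝ) ^ ((5 : ℝ) / 12 + ε) = x ^ 5 * (N : ℝ) ^ ε := by
    rw [Real.rpow_add (by linarith), hpow]
    norm_num
  have hNε : 1 ≤ (N : ℝ) ^ ε := Real.one_le_rpow hN' hε.le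
  have hx5 : 0 ≤ x ^ 5 := by positivity
  have herr : 18 * x ^ 5 + 90 * ((Nat.log 2 N + 1 : ℕ) : ℝ) ^ 2 * x ^ 5 ≤
      (18 + 90 * K ^ 2) * (N : ℝ) ^ ((5 : ℝ) / 12 + ε) := by
    rw [hsplit]
    linarith [mul_le_mul_of_nonneg_left hNε hx5, mul_le_mul_of_nonneg_right hL2 hx5]
  have hlightR := (Nat.cast_le (α := ℝ)).2 hlight'
  have hpiR := (Nat.cast_le (α := ℝ)).2 hpi
  have hPR := (Nat.cast_le (α := ℝ)).2 hP
  linarith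
end

section
/- Let c > 0 and let G be a simple graph with n ≥ 2 vertices and at least (1+c)·n edges. Then G contains a cycle of length at most (2(c+1)/c)·(log₂(n) + 1). -/
/-- The list of edges of the closed walk determined by the vertex list `l`. -/
def circuitEdgeList {V : Type*} (l : List V) : List (Sym2 V) :=
  (l.zip (l.rotate 1)).map fun p => s(p.1, p.2)

/-- `E` is the edge set of a cycle of length `k` in `G` : there are pairwise distinct
vertices `v_1, …, v_k` such that the `k` edges `{v_1,v_2}, {v_2,v_3}, …, {v_k,v_1}` all
lie in `G`, are pairwise distinct, and make up `E`. -/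
def IsCycle {V : Type*} (G : SimpleGraph V) (k : ℕ) (E : Set (Sym2 V)) : Prop :=
  ∃ l : List V, l.length = k ∧ l ≠ [] ∧ l.Nodup ∧
    (∀ p ∈ l.zip (l.rotate 1), G.Adj p.1 p.2) ∧
    (circuitEdgeList l).Nodup ∧
    E = {e | e ∈ circuitEdgeList l}

theorem SimpleGraph.Walk.zip_support_tail_append {V : Type*} {G : SimpleGraph V} {u v : V}
    (p : G.Walk u v) (w : V) :
    p.support.zip (p.support.tail ++ [w]) = p.darts.map (fun d => d.toProd) ++ [(v, w)] := by
  induction p with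
  | nil => simp
  | cons h p ih =>
    have hs := p.cons_tail_support.symm
    rw [Walk.support_cons, List.tail_cons, Walk.darts_cons, List.map_cons, List.cons_append, ← ih]
    conv_lhs => rw [hs]
    rw [List.cons_append, List.zip_cons_cons, ← hs]

/-- A walk in a subgraph `K` of `G` whose ends are joined by an edge of `G` outside `K` closes up
to a cycle of `G` that is at most one longer than the walk. -/
theorem exists_isCycle_of_walk {V : Type*} {K G : SimpleGraph V} (hKG : K ≤ G) {u v : V}
    (p : K.Walk u v) (hG : G.Adj u v) (hK : ¬ K.Adj u v) :
    ∃ k E, IsCycle G k E ∧ k ≤ p.length + 1 := by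
  classical
  set q := p.bypass
  have hq : q.IsPath := p.bypass_isPath
  have hzip : q.support.zip (q.support.rotate 1) =
      q.darts.map (fun d => d.toProd) ++ [(v, u)] := by
    rw [← q.zip_support_tail_append u]
    congr 1
    conv_lhs => rw [← q.cons_tail_support]
    rw [List.rotate_cons_succ, List.rotate_zero]
  have hedges : circuitEdgeList q.support = q.edges ++ [s(v, u)] := by
    rw [circuitEdgeList, hzip, List.map_append, List.map_map]
    rfl
  refine ⟨_, _, ⟨q.support, rfl, q.support_ne_nil, hq.support_nodup, ?_, ?_, rfl⟩, ?_⟩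
  · rw [hzip]
    intro x hx
    rcases List.mem_append.1 hx with hx | hx
    · obtain ⟨d, -, rfl⟩ := List.mem_map.1 hx
      exact hKG d.adj
    · rw [List.mem_singleton.1 hx]
      exact hG.symm
  · rw [hedges, List.nodup_append]
    refine ⟨hq.isTrail.edges_nodup, List.nodup_singleton _, ?_⟩
    rintro e he f hf rfl
    rw [List.mem_singleton.1 hf] at he
    exact hK (q.adj_of_mem_edges he).symm
  · rw [SimpleGraph.Walk.length_support]
    exact Nat.succ_le_succ p.length_bypass_le_length

/-- Breadth-first growth: if every `S ⊆ W` meets at least `a * #S` of the edges in `E`, which are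
edges of `G` inside `W`, and `G` has no cycle of length at most `2 * r`, then the ball of radius `r`
around a vertex of `W` has at least `a ^ r` vertices and is spanned by a tree. -/
theorem exists_ball_of_expansion {V : Type*} [DecidableEq V] {G : SimpleGraph V} {a : ℝ}
    (ha : 0 ≤ a) {W : Finset V} {E : Finset (Sym2 V)} (hEG : ∀ e ∈ E, e ∈ G.edgeSet)
    (hEW : ∀ e ∈ E, ∀ v ∈ e, v ∈ W)
    (hexp : ∀ S ⊆ W, a * (S.card : ℝ) ≤ ((E.filter fun e => ∃ v ∈ S, v ∈ e).card : ℝ))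
    {w : V} (hw : w ∈ W) (r : ℕ) (hcyc : ∀ k F, IsCycle G k F → 2 * r < k) :
    ∃ B ⊆ W, ∃ T ⊆ E, a ^ r ≤ (B.card : ℝ) ∧ T.card + 1 ≤ B.card ∧
      ∀ x ∈ B, ∃ p : (SimpleGraph.fromEdgeSet (T : Set (Sym2 V))).Walk w x, p.length ≤ r := by
  induction r with
  | zero =>
    refine ⟨{w}, by simpa using hw, ∅, by simp, by simp, by simp, ?_⟩
    intro x hx
    obtain rfl := Finset.mem_singleton.1 hx
    exact ⟨.nil, le_rfl⟩
  | succ r ih =>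
    obtain ⟨B, hBW, T, hTE, hB, hT, hwalk⟩ := ih fun k F h => by have := hcyc k F h; omega
    set N := (W \ B).filter fun x => ∃ y ∈ B, s(x, y) ∈ E with hN
    have hpar : ∀ x : V, ∃ y, x ∈ N → y ∈ B ∧ s(x, y) ∈ E := by
      intro x
      by_cases hx : x ∈ N
      · obtain ⟨y, hy⟩ := (Finset.mem_filter.1 hx).2
        exact ⟨y, fun _ => hy⟩
      · exact ⟨x, fun h => absurd h hx⟩
    choose f hf using hpar
    set T' := T ∪ N.image fun x => s(x, f x) with hT'
    have hT'E : T' ⊆ E := by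
      refine Finset.union_subset hTE ?_
      intro e he
      obtain ⟨x, hx, rfl⟩ := Finset.mem_image.1 he
      exact (hf x hx).2
    have hdisj : Disjoint B N := by
      rw [Finset.disjoint_left]
      intro x hxB hxN
      exact (Finset.mem_sdiff.1 (Finset.mem_filter.1 hxN).1).2 hxB
    have hcard : T'.card + 1 ≤ (B ∪ N).card := by
      have h1 := Finset.card_union_le T (N.image fun x => s(x, f x))
      have h2 : (N.image fun x => s(x, f x)).card ≤ N.card := Finset.card_image_le
      rw [← hT'] at h1
      rw [Finset.card_union_of_disjoint hdisj]
      omega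
    have hle : SimpleGraph.fromEdgeSet (T : Set (Sym2 V)) ≤
        SimpleGraph.fromEdgeSet (T' : Set (Sym2 V)) :=
      SimpleGraph.fromEdgeSet_mono (by exact_mod_cast Finset.subset_union_left)
    have hwalkB : ∀ x ∈ B,
        ∃ p : (SimpleGraph.fromEdgeSet (T' : Set (Sym2 V))).Walk w x, p.length ≤ r := by
      intro x hx
      obtain ⟨p, hp⟩ := hwalk x hx
      exact ⟨p.mapLe hle, by simpa using hp⟩
    have hwalk' : ∀ x ∈ B ∪ N,
        ∃ p : (SimpleGraph.fromEdgeSet (T' : Set (Sym2 V))).Walk w x, p.length ≤ r + 1 := by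
      intro x hx
      rcases Finset.mem_union.1 hx with hx | hx
      · obtain ⟨p, hp⟩ := hwalkB x hx
        exact ⟨p, by omega⟩
      · obtain ⟨hfB, hfE⟩ := hf x hx
        obtain ⟨p, hp⟩ := hwalkB _ hfB
        have hadj : (SimpleGraph.fromEdgeSet (T' : Set (Sym2 V))).Adj (f x) x := by
          rw [SimpleGraph.fromEdgeSet_adj]
          refine ⟨?_, (G.ne_of_adj (hEG _ hfE)).symm⟩
          rw [Sym2.eq_swap]
          exact Finset.mem_coe.2
            (Finset.mem_union_right _ (Finset.mem_image_of_mem (fun x => s(x, f x)) hx))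
        exact ⟨p.concat hadj, by simpa using hp⟩
    refine ⟨B ∪ N, Finset.union_subset hBW
      ((Finset.filter_subset _ _).trans Finset.sdiff_subset), T', hT'E, ?_, hcard, hwalk'⟩
    have htouch : (E.filter fun e => ∃ v ∈ B, v ∈ e) ⊆ T' := by
      intro e he
      obtain ⟨heE, u, huB, hue⟩ := Finset.mem_filter.1 he
      obtain ⟨v, rfl⟩ := Sym2.mem_iff_exists.1 hue
      by_contra heT
      have hv : v ∈ B ∪ N := by
        by_cases hvB : v ∈ B
        · exact Finset.mem_union_left _ hvB
        · refine Finset.mem_union_right _ (Finset.mem_filter.2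
            ⟨Finset.mem_sdiff.2 ⟨hEW _ heE v (by simp), hvB⟩, u, huB, ?_⟩)
          rwa [Sym2.eq_swap]
      obtain ⟨p, hp⟩ := hwalkB u huB
      obtain ⟨q, hq⟩ := hwalk' v hv
      have hKG : SimpleGraph.fromEdgeSet (T' : Set (Sym2 V)) ≤ G := by
        intro x y hxy
        exact hEG _ (hT'E (Finset.mem_coe.1 ((SimpleGraph.fromEdgeSet_adj _).1 hxy).1))
      obtain ⟨k, F, hk, hkl⟩ := exists_isCycle_of_walk hKG (p.reverse.append q)
        (hEG _ heE) fun h => heT (Finset.mem_coe.1 ((SimpleGraph.fromEdgeSet_adj _).1 h).1)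
      have := hcyc k F hk
      rw [SimpleGraph.Walk.length_append, SimpleGraph.Walk.length_reverse] at hkl
      omega
    have h1 : ((E.filter fun e => ∃ v ∈ B, v ∈ e).card : ℝ) ≤ ((B ∪ N).card : ℝ) := by
      have := Finset.card_le_card htouch
      exact_mod_cast (by omega : (E.filter fun e => ∃ v ∈ B, v ∈ e).card ≤ (B ∪ N).card)
    calc a ^ (r + 1) = a * a ^ r := pow_succ' a r
      _ ≤ a * B.card := mul_le_mul_of_nonneg_left hB ha
      _ ≤ _ := (hexp B hBW).trans h1

/-- A graph with at least `a * n` edges has a nonempty vertex set `W` such that every `S ⊆ W` meets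
at least `a * #S` of the edges inside `W`. -/
theorem exists_expanding_subset {V : Type*} [Fintype V] [DecidableEq V] [Nonempty V]
    (F : Finset (Sym2 V)) {a : ℝ} (hF : a * (Fintype.card V : ℝ) ≤ (F.card : ℝ)) :
    ∃ W : Finset V, W.Nonempty ∧ ∀ S ⊆ W, a * (S.card : ℝ) ≤
      (((F.filter fun e => ∀ v ∈ e, v ∈ W).filter fun e => ∃ v ∈ S, v ∈ e).card : ℝ) := by
  let P : Finset V → Prop := fun W =>
    W.Nonempty ∧ a * (W.card : ℝ) ≤ ((F.filter fun e => ∀ v ∈ e, v ∈ W).card : ℝ)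
  have hP : P Finset.univ := ⟨Finset.univ_nonempty, by simpa using hF⟩
  obtain ⟨W, -, hW⟩ := exists_minimal_le_of_wellFoundedLT P _ hP
  refine ⟨W, hW.prop.1, fun S hS => ?_⟩
  rcases S.eq_empty_or_nonempty with rfl | hSne
  · simp
  have hrest : ((F.filter fun e => ∀ v ∈ e, v ∈ W \ S).card : ℝ) ≤ a * ((W \ S).card : ℝ) := by
    rcases (W \ S).eq_empty_or_nonempty with h | h
    · rw [h, Finset.card_empty, Nat.cast_zero, mul_zero]
      have : (F.filter fun e => ∀ v ∈ e, v ∈ (∅ : Finset V)) = ∅ := by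
        refine Finset.filter_eq_empty_iff.2 fun e _ he => ?_
        induction e with
        | h x y => exact absurd (he x (by simp)) (by simp)
      rw [this]
      simp
    · by_contra! hlt
      obtain ⟨x, hx⟩ := hSne
      have := hW.le_of_le ⟨h, hlt.le⟩ Finset.sdiff_subset (hS hx)
      exact (Finset.mem_sdiff.1 this).2 hx
  have hcover : (F.filter fun e => ∀ v ∈ e, v ∈ W) ⊆
      ((F.filter fun e => ∀ v ∈ e, v ∈ W).filter fun e => ∃ v ∈ S, v ∈ e) ∪
        (F.filter fun e => ∀ v ∈ e, v ∈ W \ S) := by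
    intro e he
    simp only [Finset.mem_union, Finset.mem_filter, Finset.mem_sdiff] at he ⊢
    by_cases h : ∃ v ∈ S, v ∈ e
    · exact Or.inl ⟨he, h⟩
    · exact Or.inr ⟨he.1, fun v hv => ⟨he.2 v hv, fun hvS => h ⟨v, hvS, hv⟩⟩⟩
  have h1 := (Finset.card_le_card hcover).trans (Finset.card_union_le _ _)
  have h2 : ((F.filter fun e => ∀ v ∈ e, v ∈ W).card : ℝ) ≤
      (((F.filter fun e => ∀ v ∈ e, v ∈ W).filter fun e => ∃ v ∈ S, v ∈ e).card : ℝ) +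
        ((F.filter fun e => ∀ v ∈ e, v ∈ W \ S).card : ℝ) := by exact_mod_cast h1
  have h3 : (W.card : ℝ) = ((W \ S).card : ℝ) + (S.card : ℝ) := by
    exact_mod_cast (Finset.card_sdiff_add_card_eq_card hS).symm
  have h4 := hW.prop.2
  rw [h3] at h4
  linarith

theorem logb_one_add_le {c x : ℝ} (hc : 0 < c) (hx : 1 ≤ x) :
    Real.logb (1 + c) x ≤ (c + 1) / c * Real.logb 2 x := by
  have h1c : (0 : ℝ) < 1 + c := by linarith
  have hlog : c / (c + 1) ≤ Real.log (1 + c) := by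
    have h := Real.one_sub_inv_le_log_of_pos h1c
    have : 1 - (1 + c)⁻¹ = c / (c + 1) := by field_simp; ring
    linarith
  have hlog2 : Real.log 2 ≤ 1 := by linarith [Real.log_two_lt_d9]
  have hpos2 : 0 < Real.log 2 := Real.log_pos (by norm_num)
  have hlx : 0 ≤ Real.log x := Real.log_nonneg hx
  have hcc : 0 < c / (c + 1) := by positivity
  calc Real.logb (1 + c) x = Real.log x / Real.log (1 + c) := rfl
    _ ≤ Real.log x / (c / (c + 1)) := div_le_div_of_nonneg_left hlx hcc hlog
    _ = (c + 1) / c * Real.log x := by field_simp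
    _ ≤ (c + 1) / c * (Real.log x / Real.log 2) := by
      gcongr
      exact le_div_self hlx hpos2 hlog2

/-- A graph with `n ≥ 2` vertices and at least `(1+c)·n` edges contains a cycle of length
at most `(2(c+1)/c)·(log₂(n) + 1)`. -/
theorem stmt14 {V : Type*} [Fintype V] (G : SimpleGraph V) (c : ℝ) (hc : 0 < c)
    (hn : 2 ≤ Fintype.card V)
    (hE : (1 + c) * (Fintype.card V : ℝ) ≤ (G.edgeSet.ncard : ℝ)) :
    ∃ k : ℕ, ∃ E : Set (Sym2 V), IsCycle G k E ∧
      (k : ℝ) ≤ (2 * (c + 1) / c) * (Real.logb 2 (Fintype.card V) + 1) := by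
  classical
  have : Nonempty V := Fintype.card_pos_iff.1 (by omega)
  have hn1 : (1 : ℝ) ≤ Fintype.card V := by exact_mod_cast (by omega : 1 ≤ Fintype.card V)
  rw [Set.ncard_eq_toFinset_card'] at hE
  obtain ⟨W, ⟨w, hw⟩, hexp⟩ := exists_expanding_subset G.edgeSet.toFinset hE
  set L := Real.logb (1 + c) (Fintype.card V) with hL
  have hL0 : 0 ≤ L := Real.logb_nonneg (by linarith) hn1
  set r := ⌊L⌋₊ + 1 with hr
  have hbig : (Fintype.card V : ℝ) < (1 + c) ^ r := by
    rw [← Real.rpow_natCast, ← Real.logb_lt_iff_lt_rpow (by linarith) (by linarith)]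
    simpa [hr] using Nat.lt_floor_add_one L
  obtain ⟨k, F, hk, hkr⟩ : ∃ k F, IsCycle G k F ∧ k ≤ 2 * r := by
    by_contra! hcyc
    obtain ⟨B, -, -, -, hB, -⟩ := exists_ball_of_expansion (G := G) (by linarith : 0 ≤ 1 + c)
      (fun e he => Set.mem_toFinset.1 (Finset.mem_filter.1 he).1)
      (fun e he => (Finset.mem_filter.1 he).2) hexp hw r hcyc
    have : (B.card : ℝ) ≤ Fintype.card V := by exact_mod_cast B.card_le_univ
    linarith
  refine ⟨k, F, hk, ?_⟩
  have hk' : (k : ℝ) ≤ 2 * r := by exact_mod_cast hkr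
  have hrL : (r : ℝ) ≤ L + 1 := by
    rw [hr]
    push_cast
    linarith [Nat.floor_le hL0]
  have hone : 1 ≤ (c + 1) / c := by rw [le_div_iff₀ hc]; linarith
  have hlog := logb_one_add_le hc hn1
  have : 2 * (c + 1) / c * (Real.logb 2 (Fintype.card V) + 1) =
      2 * ((c + 1) / c * Real.logb 2 (Fintype.card V)) + 2 * ((c + 1) / c) := by ring
  linarith
end
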